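/- arXiv:1603.01458 — 8 statements merged into one kernel-verified Lean document; each statement's English description precedes it below -/
import Mathlib

section
/- Let X be a countable set, let μ and μ' be probability measures on X (functions X → [0,1] summing to 1), let K ≥ 1 and ε > 0. If μ({x ∈ X : μ(x) ≤ K·μ'(x)}) ≥ 1 − ε, then the total variation distance satisfies Σ_{x∈X} |μ(x) − μ'(x)| ≤ 2(ε + K − 1). -/
noncomputable section

/-- If `μ, μ'` are probability measures on a countable set `X`, `K ≥ 1`,
`ε > 0`, and the set `{x | μ x ≤ K * μ' x}` has `μ`-measure at least `1 - ε`, then the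
total variation distance `∑_x |μ x - μ' x|` is at most `2 * (ε + K - 1)`. -/
theorem stmt0 {X : Type*} [Countable X] (μ μ' : X → ℝ)
    (hμ0 : ∀ x, 0 ≤ μ x) (hμ1 : HasSum μ 1)
    (hμ'0 : ∀ x, 0 ≤ μ' x) (hμ'1 : HasSum μ' 1)
    (K ε : ℝ) (hK : 1 ≤ K) (hε : 0 < ε)
    (h : 1 - ε ≤ ∑' x : {x : X | μ x ≤ K * μ' x}, μ x) :
    ∑' x : X, |μ x - μ' x| ≤ 2 * (ε + K - 1) := by
  set A : Set X := {x : X | μ x ≤ K * μ' x} with hA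
  have hS : HasSum (A.indicator μ) (∑' x : A, μ x) := by
    rw [tsum_subtype]
    exact (hμ1.summable.indicator A).hasSum
  have hB := (((hμ'1.mul_left (K - 1)).add (hμ1.sub hS)).mul_left 2).sub (hμ1.sub hμ'1)
  have hle : ∀ x, |μ x - μ' x| ≤
      2 * ((K - 1) * μ' x + (μ x - A.indicator μ x)) - (μ x - μ' x) := by
    intro x
    have h0 := hμ0 x
    have h1 := hμ'0 x
    have h2 : 0 ≤ (K - 1) * μ' x := mul_nonneg (by linarith) h1
    by_cases hx : x ∈ A
    · rw [Set.indicator_of_mem hx]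
      have hx' : μ x ≤ K * μ' x := hx
      rw [abs_le]
      constructor <;> linarith
    · rw [Set.indicator_of_notMem hx, abs_le]
      constructor <;> linarith
  have hs : Summable fun x => |μ x - μ' x| := (hμ1.summable.sub hμ'1.summable).abs
  have := hasSum_le hle hs.hasSum hB
  linarith
end
end

section
/- Let G be a countable group, μ a probability measure on G, and (g_n) a sequence in G. Then the following are equivalent: (i) Σ_{g∈G} |μ^{*n}(g) − μ^{*n}(g·g_n)| → 0 as n → ∞; (ii) for every ε > 0 there exists N and, for each n ≥ N, a subset V_n ⊆ G with μ^{*n}(V_n) ≥ 1 − ε such that (1 − ε)·μ^{*n}(h) ≤ μ^{*n}(h·g_n) ≤ (1 + ε)·μ^{*n}(h) for every h ∈ V_n. -/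
noncomputable section
open Filter
open scoped Classical

/-- Convolution of two measures (as real-valued functions) on a group:
`(μ * ν)(g) = Σ_h μ(h) ν(h⁻¹ g)`. -/
def conv {G : Type*} [Group G] (μ ν : G → ℝ) : G → ℝ :=
  fun g => ∑' h : G, μ h * ν (h⁻¹ * g)

/-- `n`-fold convolution power; `convPow μ 0` is the point mass at the identity. -/
def convPow {G : Type*} [Group G] (μ : G → ℝ) : ℕ → G → ℝ
  | 0 => fun g => if g = 1 then 1 else 0
  | n + 1 => conv μ (convPow μ n)

/-- Measure of a subset: `μ(A) = Σ_{x ∈ A} μ(x)`. -/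
def measOf {G : Type*} (μ : G → ℝ) (A : Set G) : ℝ := ∑' x : A, μ x

/-- Word length of `g` with respect to `S ∪ S⁻¹`: the least `k` such that `g` is a
product of `k` elements of `S ∪ S⁻¹`. -/
def wordLength {G : Type*} [Group G] (S : Set G) (g : G) : ℕ :=
  sInf {k | ∃ l : List G, l.length = k ∧ (∀ x ∈ l, x ∈ S ∨ x⁻¹ ∈ S) ∧ l.prod = g}

theorem conv_prob {G : Type*} [Group G] (μ ν : G → ℝ)
    (hμ0 : ∀ g, 0 ≤ μ g) (hμ1 : HasSum μ 1) (hν0 : ∀ g, 0 ≤ ν g) (hν1 : HasSum ν 1) :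
    (∀ g, 0 ≤ conv μ ν g) ∧ HasSum (conv μ ν) 1 := by
  refine ⟨fun g => tsum_nonneg fun h => mul_nonneg (hμ0 h) (hν0 _), ?_⟩
  have hs : Summable (fun x : G × G => μ x.1 * ν x.2) :=
    hμ1.summable.mul_of_nonneg hν1.summable hμ0 hν0
  have h1 : HasSum (fun x : G × G => μ x.1 * ν x.2) 1 := by
    simpa using hμ1.mul hν1 hs
  let e : G × G ≃ G × G :=
    { toFun := fun x => (x.2, x.2⁻¹ * x.1)
      invFun := fun y => (y.1 * y.2, y.1)
      left_inv := fun x => by simp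
      right_inv := fun y => by simp }
  have h2 : HasSum (fun x : G × G => μ x.2 * ν (x.2⁻¹ * x.1)) 1 := (e.hasSum_iff).2 h1
  exact h2.prod_fiberwise fun g => (h2.summable.prod_factor g).hasSum

theorem convPow_prob {G : Type*} [Group G] (μ : G → ℝ)
    (hμ0 : ∀ g, 0 ≤ μ g) (hμ1 : HasSum μ 1) (n : ℕ) :
    (∀ g, 0 ≤ convPow μ n g) ∧ HasSum (convPow μ n) 1 := by
  induction n with
  | zero =>
    refine ⟨fun g => ?_, ?_⟩
    · simp only [convPow]; split_ifs <;> norm_num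
    · exact hasSum_ite_eq 1 1
  | succ n ih => exact conv_prob μ _ hμ0 hμ1 ih.1 ih.2

theorem tv_aux1 {G : Type*} (p q : G → ℝ) (hp : HasSum p 1) (hq : HasSum q 1)
    (hp0 : ∀ g, 0 ≤ p g) (ε : ℝ) (hε : 0 < ε)
    (h : ∑' x, |p x - q x| ≤ ε * ε) :
    1 - ε ≤ measOf p {x | |p x - q x| ≤ ε * p x} := by
  set V := {x | |p x - q x| ≤ ε * p x} with hV
  have hd : Summable (fun x => |p x - q x|) := (hp.summable.sub hq.summable).abs
  have hind : Summable (V.indicator p) := hp.summable.indicator V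
  have hle : ∑' x, ε * (p x - V.indicator p x) ≤ ∑' x, |p x - q x| := by
    refine Summable.tsum_le_tsum (fun x => ?_) ((hp.summable.sub hind).mul_left ε) hd
    by_cases hx : x ∈ V
    · simp [hx]
    · simp only [Set.indicator_of_notMem hx, sub_zero]
      exact (not_le.1 hx).le
  rw [tsum_mul_left, hp.summable.tsum_sub hind, hp.tsum_eq] at hle
  have : measOf p V = ∑' x, V.indicator p x := tsum_subtype V p
  rw [this]
  have := le_of_mul_le_mul_left (hle.trans h) hε
  linarith

theorem tv_aux2 {G : Type*} (p q : G → ℝ) (hp : HasSum p 1) (hq : HasSum q 1)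
    (hp0 : ∀ g, 0 ≤ p g) (hq0 : ∀ g, 0 ≤ q g) (ε : ℝ) (hε : 0 < ε) (V : Set G)
    (hV : 1 - ε ≤ measOf p V) (h : ∀ x ∈ V, (1 - ε) * p x ≤ q x) :
    ∑' x, |p x - q x| ≤ 4 * ε := by
  have hd : Summable (fun x => |p x - q x|) := (hp.summable.sub hq.summable).abs
  have hm : measOf p V = ∑' x, V.indicator p x := tsum_subtype V p
  have hind : HasSum (V.indicator p) (measOf p V) := by
    rw [hm]; exact (hp.summable.indicator V).hasSum
  have hR : HasSum (fun x => (q x - p x) + 2 * (ε * p x + (p x - V.indicator p x)))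
      ((1 - 1) + 2 * (ε * 1 + (1 - measOf p V))) :=
    (hq.sub hp).add (((hp.mul_left ε).add (hp.sub hind)).mul_left 2)
  have hle := hasSum_le (fun x => ?_) hd.hasSum hR
  · linarith
  · have h0 := hp0 x
    have h1 := hq0 x
    have h2 : 0 ≤ ε * p x := mul_nonneg hε.le h0
    by_cases hx : x ∈ V
    · have := h x hx
      simp only [Set.indicator_of_mem hx]
      exact abs_le.2 ⟨by linarith, by linarith⟩
    · simp only [Set.indicator_of_notMem hx]
      exact abs_le.2 ⟨by linarith, by linarith⟩

/-- For a probability measure `μ` on a countable group `G` and a sequence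
`(gₙ)` in `G`: the total variation `Σ_g |μ^{*n}(g) - μ^{*n}(g gₙ)|` tends to `0` iff the
transition probabilities are almost invariant with respect to `(gₙ)`. -/
theorem stmt2 {G : Type*} [Group G] [Countable G] (μ : G → ℝ)
    (hμ0 : ∀ g, 0 ≤ μ g) (hμ1 : HasSum μ 1) (gseq : ℕ → G) :
    Tendsto (fun n => ∑' x : G, |convPow μ n x - convPow μ n (x * gseq n)|)
        atTop (nhds 0) ↔
      ∀ ε > (0 : ℝ), ∃ N : ℕ, ∀ n ≥ N, ∃ V : Set G,
        1 - ε ≤ measOf (convPow μ n) V ∧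
        ∀ h ∈ V, (1 - ε) * convPow μ n h ≤ convPow μ n (h * gseq n) ∧
          convPow μ n (h * gseq n) ≤ (1 + ε) * convPow μ n h := by
  have hp := fun n => convPow_prob μ hμ0 hμ1 n
  have hq : ∀ n, HasSum (fun x => convPow μ n (x * gseq n)) 1 := fun n =>
    ((Equiv.mulRight (gseq n)).hasSum_iff).2 (hp n).2
  constructor
  · intro h ε hε
    obtain ⟨N, hN⟩ := eventually_atTop.1 (h.eventually_le_const (mul_pos hε hε))
    refine ⟨N, fun n hn => ⟨_, tv_aux1 _ _ (hp n).2 (hq n) (hp n).1 ε hε (hN n hn), ?_⟩⟩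
    intro x hx
    have := abs_le.1 (by simpa using hx : |convPow μ n x - convPow μ n (x * gseq n)| ≤ ε * convPow μ n x)
    constructor <;> linarith [this.1, this.2]
  · intro h
    rw [Metric.tendsto_atTop]
    intro δ hδ
    obtain ⟨N, hN⟩ := h (δ / 8) (by positivity)
    refine ⟨N, fun n hn => ?_⟩
    obtain ⟨V, hV, hV2⟩ := hN n hn
    have := tv_aux2 _ _ (hp n).2 (hq n) (hp n).1 (fun x => (hp n).1 _) (δ / 8)
      (by positivity) V hV (fun x hx => (hV2 x hx).1)
    rw [Real.dist_eq, sub_zero, abs_of_nonneg (tsum_nonneg fun x => abs_nonneg _)]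
    linarith
end
end

section
/- Let G be a group generated by the (finite) support S of a probability measure μ on G, and let F : ℕ → (0,∞) be such that for all n and all s ∈ S it holds Σ_{h∈G} |μ^{*n}(h) − μ^{*n}(h·s)| ≤ 1/F(n). Let f : ℕ → ℝ≥0 satisfy f(n)/F(n) → 0 as n → ∞. Then the distributions of the random walk (G,μ) are individually almost invariant on the scale f(n): for every ε > 0 and every sequence (h_n) in G with l_S(h_n) ≤ f(n), there exists N and, for each n ≥ N, a subset V_n ⊆ G with μ^{*n}(V_n) ≥ 1 − ε such that (1 − ε)·μ^{*n}(g) ≤ μ^{*n}(g·h_n) ≤ (1 + ε)·μ^{*n}(g) for every g ∈ V_n. -/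
noncomputable section
open Filter
open scoped Classical

lemma convPow_nonneg' {G : Type*} [Group G] (μ : G → ℝ) (hμ0 : ∀ g, 0 ≤ μ g) (n : ℕ) :
    ∀ g, 0 ≤ convPow μ n g := by
  induction n with
  | zero => intro g; simp only [convPow]; split_ifs <;> norm_num
  | succ n ih => intro g; exact tsum_nonneg fun h => mul_nonneg (hμ0 h) (ih _)

lemma convPow_hasSum {G : Type*} [Group G] (μ : G → ℝ) (hμ1 : HasSum μ 1)
    (hfin : (Function.support μ).Finite) (n : ℕ) : HasSum (convPow μ n) 1 := by
  induction n with
  | zero => exact hasSum_ite_eq (1 : G) (1 : ℝ)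
  | succ n ih =>
    have hz : ∀ h ∉ hfin.toFinset, μ h = 0 := by
      intro h hh; simpa using hh
    have h1 : ∑ h ∈ hfin.toFinset, μ h = 1 :=
      (hasSum_sum_of_ne_finset_zero hz).unique hμ1
    have h2 : convPow μ (n+1) =
        fun g => ∑ h ∈ hfin.toFinset, μ h * convPow μ n (h⁻¹ * g) := by
      funext g
      exact tsum_eq_sum fun h hh => by rw [hz h hh, zero_mul]
    rw [h2, ← h1]
    apply hasSum_sum
    intro h _
    have := ((Equiv.mulLeft h⁻¹).hasSum_iff.mpr ih).mul_left (μ h)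
    simpa [Function.comp_def] using this

lemma summable_diff {G : Type*} [Group G] {p : G → ℝ} (hp : Summable p) (a b : G) :
    Summable fun x => |p (x * a) - p (x * b)| :=
  (((Equiv.mulRight a).summable_iff.mpr hp).sub ((Equiv.mulRight b).summable_iff.mpr hp)).abs

lemma list_bound {G : Type*} [Group G] {p : G → ℝ} (hp : Summable p) (S : Set G) (c : ℝ)
    (hS : ∀ s ∈ S, ∑' x : G, |p x - p (x * s)| ≤ c) (l : List G)
    (hl : ∀ x ∈ l, x ∈ S ∨ x⁻¹ ∈ S) :
    ∑' x : G, |p x - p (x * l.prod)| ≤ l.length * c := by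
  induction l with
  | nil => simp
  | cons a t ih =>
    have iht := ih fun x hx => hl x (List.mem_cons_of_mem _ hx)
    have ha : ∑' x : G, |p x - p (x * a)| ≤ c := by
      rcases hl a List.mem_cons_self with h | h
      · exact hS a h
      · rw [← (Equiv.mulRight a⁻¹).tsum_eq]
        refine le_trans (le_of_eq (tsum_congr fun x => ?_)) (hS _ h)
        simp [abs_sub_comm]
    have s1 : Summable fun x => |p x - p (x * a)| := by simpa using summable_diff hp 1 a
    have s2 := summable_diff hp a (a * t.prod)
    have s3 : Summable fun x => |p x - p (x * (a * t.prod))| := by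
      simpa using summable_diff hp 1 (a * t.prod)
    have e2 : ∑' x : G, |p (x * a) - p (x * (a * t.prod))| =
        ∑' x : G, |p x - p (x * t.prod)| := by
      rw [← (Equiv.mulRight a).tsum_eq fun x => |p x - p (x * t.prod)|]
      simp [mul_assoc]
    have := s3.tsum_le_tsum (fun x => abs_sub_le (p x) (p (x * a)) _) (s1.add s2)
    rw [s1.tsum_add s2, e2] at this
    simp only [List.prod_cons, List.length_cons]
    push_cast
    linarith

/-- Suppose the (finite) support `S` of a probability measure `μ` generates
`G`, and `Σ_h |μ^{*n}(h) - μ^{*n}(h s)| ≤ 1/F(n)` for every `n` and every `s ∈ S`. If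
`f(n)/F(n) → 0`, then the distributions of `(G, μ)` are individually almost invariant on the
scale `f(n)`. -/
theorem stmt4 {G : Type*} [Group G] [Countable G] (μ : G → ℝ)
    (hμ0 : ∀ g, 0 ≤ μ g) (hμ1 : HasSum μ 1)
    (hfin : (Function.support μ).Finite)
    (hgen : Subgroup.closure (Function.support μ) = ⊤)
    (F : ℕ → ℝ) (hF : ∀ n, 0 < F n)
    (hinv : ∀ n : ℕ, ∀ s ∈ Function.support μ,
      ∑' x : G, |convPow μ n x - convPow μ n (x * s)| ≤ 1 / F n)
    (f : ℕ → ℝ) (hf0 : ∀ n, 0 ≤ f n)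
    (hlim : Tendsto (fun n => f n / F n) atTop (nhds 0)) :
    ∀ ε > (0 : ℝ), ∀ hseq : ℕ → G,
      (∀ n, (wordLength (Function.support μ) (hseq n) : ℝ) ≤ f n) →
      ∃ N : ℕ, ∀ n ≥ N, ∃ V : Set G,
        1 - ε ≤ measOf (convPow μ n) V ∧
        ∀ g ∈ V, (1 - ε) * convPow μ n g ≤ convPow μ n (g * hseq n) ∧
          convPow μ n (g * hseq n) ≤ (1 + ε) * convPow μ n g := by
  intro ε hε hseq hlen
  have hev : ∀ᶠ n in atTop, f n / F n < ε ^ 2 := hlim.eventually_lt_const (by positivity)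
  obtain ⟨N, hN⟩ := eventually_atTop.mp hev
  refine ⟨N, fun n hn => ?_⟩
  set p := convPow μ n with hpdef
  have hp0 : ∀ g, 0 ≤ p g := convPow_nonneg' μ hμ0 n
  have hp1 : HasSum p 1 := convPow_hasSum μ hμ1 hfin n
  have hD : ∑' x : G, |p x - p (x * hseq n)| ≤ ε ^ 2 := by
    have hne : {k | ∃ l : List G, l.length = k ∧
        (∀ x ∈ l, x ∈ Function.support μ ∨ x⁻¹ ∈ Function.support μ) ∧
        l.prod = hseq n}.Nonempty := by
      have hm : hseq n ∈ Subgroup.closure (Function.support μ) := by rw [hgen]; trivial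
      rw [← Subgroup.mem_toSubmonoid, Subgroup.closure_toSubmonoid] at hm
      obtain ⟨l, hl, hlp⟩ := Submonoid.exists_list_of_mem_closure hm
      exact ⟨_, l, rfl, fun x hx => hl x hx, hlp⟩
    obtain ⟨l, hll, hl, hlp⟩ := Nat.sInf_mem hne
    have hb := list_bound hp1.summable _ _ (hinv n) l hl
    rw [hlp] at hb
    have hle : (l.length : ℝ) ≤ f n := by rw [hll]; exact hlen n
    have h3 : (l.length : ℝ) * (1 / F n) ≤ f n * (1 / F n) :=
      mul_le_mul_of_nonneg_right hle (by have := hF n; positivity)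
    have h4 := hN n hn
    rw [mul_one_div, mul_one_div] at h3
    rw [mul_one_div] at hb
    linarith
  have sD : Summable fun x => |p x - p (x * hseq n)| := by
    simpa using summable_diff hp1.summable 1 (hseq n)
  refine ⟨{g | |p g - p (g * hseq n)| ≤ ε * p g}, ?_, ?_⟩
  · set V : Set G := {g | |p g - p (g * hseq n)| ≤ ε * p g} with hV
    have hsplit : measOf p V + ∑' x : (Vᶜ : Set G), p x = 1 := by
      rw [← hp1.tsum_eq]
      exact (hp1.summable.subtype V).tsum_add_tsum_compl (hp1.summable.subtype _)
    have hB : ε * ∑' x : (Vᶜ : Set G), p x ≤ ε ^ 2 := by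
      rw [← tsum_mul_left]
      refine le_trans (Summable.tsum_le_tsum (fun x => ?_)
        ((hp1.summable.subtype _).mul_left ε) (sD.subtype Vᶜ)) (le_trans
        (sD.tsum_subtype_le _ Vᶜ (fun x => abs_nonneg _)) hD)
      have := x.2
      simp only [hV, Set.mem_compl_iff, Set.mem_ofPred_eq, not_le] at this
      exact this.le
    have : ∑' x : (Vᶜ : Set G), p x ≤ ε := by
      rw [pow_two] at hB
      exact le_of_mul_le_mul_left hB hε
    linarith
  · intro g hg
    have := abs_le.mp (show |p g - p (g * hseq n)| ≤ ε * p g from hg)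
    constructor <;> linarith [this.1, this.2]
end
end

section
/- Let G be a group generated by a finite set S, and let μ be a finitely supported aperiodic probability measure on G whose support generates G. Let H(n) = −Σ_{g∈G} μ^{*n}(g)·log μ^{*n}(g) be the entropy of μ^{*n}. If f : ℕ → ℝ≥0 satisfies f(n)·√(H(n+1) − H(n)) → 0 as n → ∞, then the distributions of the random walk (G,μ) are individually almost invariant on the scale f(n): for every ε > 0 and every sequence (h_n) in G with l_S(h_n) ≤ f(n), there exists N and, for each n ≥ N, a subset V_n ⊆ G with μ^{*n}(V_n) ≥ 1 − ε such that (1 − ε)·μ^{*n}(g) ≤ μ^{*n}(g·h_n) ≤ (1 + ε)·μ^{*n}(g) for every g ∈ V_n. -/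
noncomputable section
open Filter
open scoped Classical

/-- Entropy of the `n`-th convolution power of `μ`. -/
def entropyOf {G : Type*} [Group G] (μ : G → ℝ) (n : ℕ) : ℝ :=
  -∑' g : G, convPow μ n g * Real.log (convPow μ n g)

lemma aux_pt (p q : ℝ) (hp : 0 ≤ p) (hq : 0 ≤ q) (hpq : 0 < p → 0 < q) :
    2 * p - 2 * (√p * √q) ≤ p * Real.log p - p * Real.log q := by
  rcases hp.eq_or_lt with h | h
  · subst h; simp
  have hq' := hpq h
  have a := Real.sqrt_pos.2 h
  have b := Real.sqrt_pos.2 hq'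
  have h1 := Real.log_le_sub_one_of_pos (div_pos b a)
  rw [Real.log_div b.ne' a.ne', Real.log_sqrt hp, Real.log_sqrt hq] at h1
  have h2 : p * (√q / √p) = √p * √q := by
    have : p = √p * √p := (Real.mul_self_sqrt hp).symm
    field_simp
    nlinarith
  nlinarith [mul_le_mul_of_nonneg_left h1 hp]

lemma aux_pinsker_fin {α : Type*} (B : Finset α) (p q : α → ℝ) (hp : ∀ a, 0 ≤ p a)
    (hq : ∀ a, 0 ≤ q a) (hpq : ∀ a, 0 < p a → 0 < q a) (sp : ∑ a ∈ B, p a = 1)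
    (sq : ∑ a ∈ B, q a = 1) :
    (∑ a ∈ B, |p a - q a|) ^ 2 ≤ 4 * ∑ a ∈ B, (p a * Real.log (p a) - p a * Real.log (q a)) := by
  have e1 : ∀ a, |p a - q a| = |√(p a) - √(q a)| * (√(p a) + √(q a)) := by
    intro a
    have h := Real.mul_self_sqrt (hp a)
    have h' := Real.mul_self_sqrt (hq a)
    rw [← abs_of_nonneg (add_nonneg (Real.sqrt_nonneg (p a)) (Real.sqrt_nonneg (q a))), ← abs_mul]
    congr 1
    nlinarith
  have cs := Finset.sum_mul_sq_le_sq_mul_sq B (fun a => |√(p a) - √(q a)|)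
    (fun a => √(p a) + √(q a))
  have h2 : ∑ a ∈ B, (√(p a) + √(q a)) ^ 2 ≤ 4 := by
    calc _ ≤ ∑ a ∈ B, (2 * p a + 2 * q a) := by
          apply Finset.sum_le_sum
          intro a _
          have h := Real.mul_self_sqrt (hp a)
          have h' := Real.mul_self_sqrt (hq a)
          nlinarith [sq_nonneg (√(p a) - √(q a))]
      _ = 4 := by rw [Finset.sum_add_distrib, ← Finset.mul_sum, ← Finset.mul_sum, sp, sq]; norm_num
  have h3 : ∑ a ∈ B, |√(p a) - √(q a)| ^ 2 ≤
      ∑ a ∈ B, (p a * Real.log (p a) - p a * Real.log (q a)) := by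
    calc _ = ∑ a ∈ B, ((2 * p a - 2 * (√(p a) * √(q a))) + (q a - p a)) := by
          apply Finset.sum_congr rfl
          intro a _
          have h := Real.mul_self_sqrt (hp a)
          have h' := Real.mul_self_sqrt (hq a)
          rw [sq_abs]
          nlinarith
      _ = ∑ a ∈ B, (2 * p a - 2 * (√(p a) * √(q a))) := by
          rw [Finset.sum_add_distrib, Finset.sum_sub_distrib (f := q), sp, sq]; simp
      _ ≤ _ := Finset.sum_le_sum fun a _ => aux_pt _ _ (hp a) (hq a) (hpq a)
  have h4 : 0 ≤ ∑ a ∈ B, |√(p a) - √(q a)| ^ 2 := Finset.sum_nonneg fun a _ => by positivity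
  simp_rw [e1]
  nlinarith

lemma aux_pinsker {α : Type*} (p q : α → ℝ) (hp : ∀ a, 0 ≤ p a)
    (hq : ∀ a, 0 ≤ q a) (hpq : ∀ a, 0 < p a → 0 < q a)
    (fp : (Function.support p).Finite) (fq : (Function.support q).Finite)
    (sp : ∑' a, p a = 1) (sq : ∑' a, q a = 1) :
    (∑' a, |p a - q a|) ^ 2 ≤ 4 * ∑' a, (p a * Real.log (p a) - p a * Real.log (q a)) := by
  classical
  set B := fp.toFinset ∪ fq.toFinset with hB
  have zp : ∀ a ∉ B, p a = 0 := by intro a ha; by_contra h; simp [hB, h] at ha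
  have zq : ∀ a ∉ B, q a = 0 := by intro a ha; by_contra h; simp [hB, h] at ha
  rw [tsum_eq_sum (s := B) (by intro a ha; simp [zp a ha, zq a ha]),
    tsum_eq_sum (s := B) (by intro a ha; simp [zp a ha])]
  rw [tsum_eq_sum (s := B) zp] at sp
  rw [tsum_eq_sum (s := B) zq] at sq
  exact aux_pinsker_fin B p q hp hq hpq sp sq

/-- L1 distance -/
def l1d {α : Type*} (p q : α → ℝ) : ℝ := ∑' a, |p a - q a|

lemma aux_summ {α : Type*} {p q : α → ℝ} (fp : (Function.support p).Finite)
    (fq : (Function.support q).Finite) : Summable fun a => |p a - q a| :=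
  ((summable_of_hasFiniteSupport fp).sub (summable_of_hasFiniteSupport fq)).abs

lemma l1d_triangle {α : Type*} {p q r : α → ℝ} (fp : (Function.support p).Finite)
    (fq : (Function.support q).Finite) (fr : (Function.support r).Finite) :
    l1d p r ≤ l1d p q + l1d q r := by
  unfold l1d
  rw [← (aux_summ fp fq).tsum_add (aux_summ fq fr)]
  exact (aux_summ fp fr).tsum_le_tsum (fun a => abs_sub_le _ _ _)
    ((aux_summ fp fq).add (aux_summ fq fr))

lemma l1d_comm {α : Type*} (p q : α → ℝ) : l1d p q = l1d q p := by
  unfold l1d; simp_rw [abs_sub_comm]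

/-- right translate -/
def rtr {G : Type*} [Group G] (x : G) (p : G → ℝ) : G → ℝ := fun g => p (g * x⁻¹)

lemma rtr_mul {G : Type*} [Group G] (x y : G) (p : G → ℝ) : rtr (x * y) p = rtr y (rtr x p) := by
  funext g; simp [rtr, mul_assoc]

lemma rtr_one {G : Type*} [Group G] (p : G → ℝ) : rtr 1 p = p := by
  funext g; simp [rtr]

lemma tsum_rtr {G : Type*} [Group G] (x : G) (p : G → ℝ) : ∑' g, p (g * x⁻¹) = ∑' g, p g :=
  (Equiv.mulRight x⁻¹).tsum_eq p

lemma l1d_rtr {G : Type*} [Group G] (x : G) (p q : G → ℝ) :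
    l1d (rtr x p) (rtr x q) = l1d p q :=
  (Equiv.mulRight x⁻¹).tsum_eq (fun a => |p a - q a|)

lemma fin_rtr {G : Type*} [Group G] (x : G) {p : G → ℝ} (h : (Function.support p).Finite) :
    (Function.support (rtr x p)).Finite := by
  refine (h.preimage ((Equiv.mulRight x⁻¹).injective.injOn)).subset ?_
  intro g hg; exact hg

/-- abstract package of properties of the convolution powers -/
structure Walk0 {G : Type*} [Group G] (F : Finset G) (μ : G → ℝ) (ν : ℕ → G → ℝ) : Prop where
  mpos : ∀ s ∈ F, 0 < μ s
  msum : ∑ s ∈ F, μ s = 1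
  zero : ∀ g, ν 0 g = if g = 1 then 1 else 0
  left : ∀ n g, ν (n + 1) g = ∑ s ∈ F, μ s * ν n (s⁻¹ * g)
  right : ∀ n g, ν (n + 1) g = ∑ s ∈ F, μ s * ν n (g * s⁻¹)
  nonneg : ∀ n g, 0 ≤ ν n g
  fin : ∀ n, (Function.support (ν n)).Finite
  sum : ∀ n, ∑' g, ν n g = 1

lemma walk0 {G : Type*} [Group G] (μ : G → ℝ) (hμ0 : ∀ g, 0 ≤ μ g) (hμ1 : HasSum μ 1)
    (hfin : (Function.support μ).Finite) : Walk0 hfin.toFinset μ (convPow μ) := by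
  have z : ∀ g ∉ hfin.toFinset, μ g = 0 := by intro g hg; simpa using hg
  have left : ∀ n g, convPow μ (n + 1) g = ∑ s ∈ hfin.toFinset, μ s * convPow μ n (s⁻¹ * g) := by
    intro n g
    exact tsum_eq_sum (fun s hs => by simp [z s hs])
  have msum : ∑ s ∈ hfin.toFinset, μ s = 1 := by
    rw [← hμ1.tsum_eq]; exact (tsum_eq_sum z).symm
  have fin : ∀ n, (Function.support (convPow μ n)).Finite := by
    intro n
    induction n with
    | zero => exact (Set.finite_singleton 1).subset (by intro g hg; simpa [convPow] using hg)
    | succ n ih =>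
      refine (Set.Finite.image2 (fun a b => a * b) hfin ih).subset ?_
      intro g hg
      rw [Function.mem_support, left] at hg
      obtain ⟨s, hs, h⟩ := Finset.exists_ne_zero_of_sum_ne_zero hg
      exact ⟨s, by simpa using hs, s⁻¹ * g, (mul_ne_zero_iff.1 h).2, by simp⟩
  refine ⟨?_, msum, fun g => rfl, left, ?_, ?_, fin, ?_⟩
  · intro s hs
    exact lt_of_le_of_ne (hμ0 s) (Ne.symm (by simpa using hs))
  · intro n
    induction n with
    | zero =>
      intro g
      rw [left]
      apply Finset.sum_congr rfl
      intro s _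
      simp only [convPow, inv_mul_eq_one, mul_inv_eq_one, eq_comm]
    | succ n ih =>
      intro g
      rw [left]
      have e : ∀ s, μ s * convPow μ (n + 1) (s⁻¹ * g) = ∑ t ∈ hfin.toFinset,
          μ s * (μ t * convPow μ n (s⁻¹ * g * t⁻¹)) := by
        intro s; rw [ih, Finset.mul_sum]
      rw [Finset.sum_congr rfl fun s _ => e s, Finset.sum_comm]
      apply Finset.sum_congr rfl
      intro t _
      rw [left, Finset.mul_sum]
      apply Finset.sum_congr rfl
      intro s _
      rw [← mul_assoc s⁻¹]
      ring
  · intro n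
    induction n with
    | zero => intro g; simp only [convPow]; split_ifs <;> norm_num
    | succ n ih =>
      intro g
      rw [left]
      exact Finset.sum_nonneg fun s _ => mul_nonneg (hμ0 s) (ih _)
  · intro n
    induction n with
    | zero => simp [convPow]
    | succ n ih =>
      simp_rw [left]
      have e : ∀ s : G, ∑' g, convPow μ n (s⁻¹ * g) = 1 := fun s =>
        ((Equiv.mulLeft s⁻¹).tsum_eq (convPow μ n)).trans ih
      have sm : ∀ s : G, Summable fun g => convPow μ n (s⁻¹ * g) := fun s =>
        ((Equiv.mulLeft s⁻¹).summable_iff).2 (summable_of_hasFiniteSupport (fin n))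
      rw [Summable.tsum_finsetSum (fun s _ => (sm s).mul_left _)]
      simp_rw [tsum_mul_left, e, mul_one]
      exact msum

section W
variable {G : Type*} [Group G] {F : Finset G} {μ : G → ℝ} {ν : ℕ → G → ℝ}

lemma Walk0.kl (W : Walk0 F μ ν) (n : ℕ) :
    (-∑' g, ν (n+1) g * Real.log (ν (n+1) g)) - (-∑' g, ν n g * Real.log (ν n g)) =
    ∑ s ∈ F, μ s * ∑' g, (rtr s (ν n) g * Real.log (rtr s (ν n) g)
      - rtr s (ν n) g * Real.log (ν (n+1) g)) := by
  have s1 : ∀ s, Summable fun g => rtr s (ν n) g * Real.log (rtr s (ν n) g) := fun s =>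
    summable_of_hasFiniteSupport ((fin_rtr s (W.fin n)).subset (by
      intro g hg; exact (mul_ne_zero_iff.1 hg).1))
  have s2 : ∀ s, Summable fun g => rtr s (ν n) g * Real.log (ν (n+1) g) := fun s =>
    summable_of_hasFiniteSupport ((fin_rtr s (W.fin n)).subset (by
      intro g hg; exact (mul_ne_zero_iff.1 hg).1))
  have e1 : ∀ s, ∑' g, rtr s (ν n) g * Real.log (rtr s (ν n) g) =
      ∑' g, ν n g * Real.log (ν n g) := fun s => tsum_rtr s (fun g => ν n g * Real.log (ν n g))
  have e2 : ∑' g, ν (n+1) g * Real.log (ν (n+1) g) =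
      ∑ s ∈ F, μ s * ∑' g, rtr s (ν n) g * Real.log (ν (n+1) g) := by
    simp_rw [← tsum_mul_left]
    rw [← Summable.tsum_finsetSum (fun s _ => (s2 s).mul_left _)]
    congr 1
    funext g
    conv_lhs => enter [1]; rw [W.right]
    rw [Finset.sum_mul]
    apply Finset.sum_congr rfl
    intro s _
    simp only [rtr]; ring
  simp_rw [fun s => (s1 s).tsum_sub (s2 s), e1, mul_sub]
  rw [Finset.sum_sub_distrib, ← e2, ← Finset.sum_mul, W.msum]
  ring

lemma Walk0.step (W : Walk0 F μ ν) {s : G} (hs : s ∈ F) : ∃ C : ℝ, 0 ≤ C ∧ ∀ n,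
    l1d (rtr s (ν n)) (ν (n + 1)) ≤ C * √((-∑' g, ν (n+1) g * Real.log (ν (n+1) g)) -
      (-∑' g, ν n g * Real.log (ν n g))) := by
  refine ⟨√(4 / μ s), by positivity, fun n => ?_⟩
  rw [← Real.sqrt_mul (by have := W.mpos s hs; positivity)]
  apply Real.le_sqrt_of_sq_le
  rw [W.kl n]
  have P : ∀ t ∈ F, (l1d (rtr t (ν n)) (ν (n + 1))) ^ 2 ≤ 4 * ∑' g, (rtr t (ν n) g *
      Real.log (rtr t (ν n) g) - rtr t (ν n) g * Real.log (ν (n+1) g)) := by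
    intro t ht
    refine aux_pinsker _ _ (fun g => W.nonneg n _) (W.nonneg (n+1)) ?_ (fin_rtr t (W.fin n))
      (W.fin (n+1)) ((tsum_rtr t (ν n)).trans (W.sum n)) (W.sum (n+1))
    intro g hg
    rw [W.right]
    exact Finset.sum_pos' (fun u hu => mul_nonneg (W.mpos u hu).le (W.nonneg _ _))
      ⟨t, ht, mul_pos (W.mpos t ht) hg⟩
  have m := W.mpos s hs
  have := Finset.single_le_sum (f := fun t => μ t * ∑' g, (rtr t (ν n) g *
      Real.log (rtr t (ν n) g) - rtr t (ν n) g * Real.log (ν (n+1) g))) (s := F)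
    (fun t ht => mul_nonneg (W.mpos t ht).le (by nlinarith [P t ht, sq_nonneg (l1d (rtr t (ν n)) (ν (n + 1)))])) hs
  refine (P s hs).trans ?_
  rw [div_mul_eq_mul_div, le_div_iff₀ m]
  nlinarith

lemma Walk0.contr (W : Walk0 F μ ν) (x : G) (n k : ℕ) :
    l1d (rtr x (ν (n+1))) (ν (n+1+k)) ≤ l1d (rtr x (ν n)) (ν (n+k)) := by
  have sm := aux_summ (fin_rtr x (W.fin n)) (W.fin (n+k))
  have sm' : ∀ s : G, Summable fun g => |rtr x (ν n) (s⁻¹ * g) - ν (n+k) (s⁻¹ * g)| := fun s =>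
    (Equiv.mulLeft s⁻¹).summable_iff.2 sm
  have e : ∀ s : G, ∑' g, |rtr x (ν n) (s⁻¹ * g) - ν (n+k) (s⁻¹ * g)| =
      l1d (rtr x (ν n)) (ν (n+k)) := fun s =>
    (Equiv.mulLeft s⁻¹).tsum_eq (fun g => |rtr x (ν n) g - ν (n+k) g|)
  calc l1d (rtr x (ν (n+1))) (ν (n+1+k))
      ≤ ∑' g, ∑ s ∈ F, μ s * |rtr x (ν n) (s⁻¹ * g) - ν (n+k) (s⁻¹ * g)| := by
        refine (aux_summ (fin_rtr x (W.fin (n+1))) (W.fin (n+1+k))).tsum_le_tsum ?_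
          (summable_sum fun s _ => (sm' s).mul_left _)
        intro g
        rw [show n + 1 + k = (n + k) + 1 by ring, W.left (n+k)]
        simp only [rtr]
        rw [W.left n, ← Finset.sum_sub_distrib]
        refine (Finset.abs_sum_le_sum_abs _ _).trans (Finset.sum_le_sum fun s hs => ?_)
        rw [← mul_sub, abs_mul, abs_of_pos (W.mpos s hs), mul_assoc]
    _ = _ := by
        rw [Summable.tsum_finsetSum (fun s _ => (sm' s).mul_left _)]
        simp_rw [tsum_mul_left, e]
        rw [← Finset.sum_mul, W.msum, one_mul]

lemma Walk0.contr' (W : Walk0 F μ ν) (x : G) (n m k : ℕ) :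
    l1d (rtr x (ν (n+m))) (ν (n+m+k)) ≤ l1d (rtr x (ν n)) (ν (n+k)) := by
  induction m with
  | zero => simp
  | succ m ih => exact (W.contr x (n+m) k).trans ih

/-- closeness property -/
def Cl (ν : ℕ → G → ℝ) (δ : ℕ → ℝ) (x : G) (k : ℕ) : Prop :=
  ∃ C : ℝ, 0 ≤ C ∧ ∀ n, l1d (rtr x (ν n)) (ν (n + k)) ≤ C * δ n

variable {δ : ℕ → ℝ}

lemma Walk0.cl_mul (W : Walk0 F μ ν) {x y : G} {k m : ℕ} (hx : Cl ν δ x k) (hy : Cl ν δ y m) :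
    Cl ν δ (x * y) (k + m) := by
  obtain ⟨C, hC, h⟩ := hx
  obtain ⟨C', hC', h'⟩ := hy
  refine ⟨C + C', by positivity, fun n => ?_⟩
  have t := l1d_triangle (fin_rtr y (fin_rtr x (W.fin n))) (fin_rtr y (W.fin (n+k)))
    (W.fin (n+k+m))
  rw [l1d_rtr] at t
  have := W.contr' y n k m
  rw [rtr_mul, ← add_assoc]
  linarith [h n, h' n]

lemma Walk0.cl_cancel (W : Walk0 F μ ν) {x : G} {k m : ℕ} (hx : Cl ν δ x (m + k))
    (hy : Cl ν δ 1 k) : Cl ν δ x m := by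
  obtain ⟨C, hC, h⟩ := hx
  obtain ⟨C', hC', h'⟩ := hy
  refine ⟨C + C', by positivity, fun n => ?_⟩
  have t := l1d_triangle (fin_rtr x (W.fin n)) (W.fin (n+(m+k))) (W.fin (n+m))
  have := W.contr' 1 n m k
  rw [rtr_one, l1d_comm, rtr_one, add_assoc] at this
  have h2 := h' n
  rw [rtr_one] at h2
  linarith [h n]

lemma Walk0.cl_zero (W : Walk0 F μ ν) (hδ : ∀ n, 0 ≤ δ n) : Cl ν δ 1 0 :=
  ⟨0, le_rfl, fun n => by simp [rtr_one, l1d]⟩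

lemma Walk0.cl_inv (W : Walk0 F μ ν) {x : G} (hx : Cl ν δ x 0) : Cl ν δ x⁻¹ 0 := by
  obtain ⟨C, hC, h⟩ := hx
  refine ⟨C, hC, fun n => ?_⟩
  have := h n
  rw [← l1d_rtr x⁻¹, ← rtr_mul, mul_inv_cancel, rtr_one, l1d_comm] at this
  exact this

lemma Walk0.cl_of_pos (W : Walk0 F μ ν) (hδ : ∀ n, 0 ≤ δ n) (hs : ∀ s ∈ F, Cl ν δ s 1) (k : ℕ) :
    ∀ x, 0 < ν k x → Cl ν δ x k := by
  induction k with
  | zero =>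
    intro x hx
    rw [W.zero] at hx
    by_cases h : x = 1
    · rw [h]; exact W.cl_zero hδ
    · simp [h] at hx
  | succ k ih =>
    intro x hx
    rw [W.right] at hx
    obtain ⟨s, hsF, h⟩ := Finset.exists_ne_zero_of_sum_ne_zero hx.ne'
    have := W.cl_mul (ih (x * s⁻¹) (lt_of_le_of_ne (W.nonneg _ _)
      (mul_ne_zero_iff.1 h).2.symm)) (hs s hsF)
    simpa using this

lemma Walk0.cl_one (W : Walk0 F μ ν) (hδ : ∀ n, 0 ≤ δ n) (hs : ∀ s ∈ F, Cl ν δ s 1)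
    (haper : ∀ d : ℕ, (∀ n : ℕ, 1 ≤ n → 0 < ν n 1 → d ∣ n) → d = 1) : Cl ν δ 1 1 := by
  have ex : ∃ d, 1 ≤ d ∧ Cl ν δ 1 d := by
    by_contra hno
    have := haper 2 (fun n hn hp => (hno ⟨n, hn, W.cl_of_pos hδ hs n 1 hp⟩).elim)
    omega
  obtain ⟨h1, h2⟩ := Nat.find_spec ex
  set d := Nat.find ex with hd
  have mulc : ∀ q, Cl ν δ 1 (d * q) := by
    intro q
    induction q with
    | zero => exact W.cl_zero hδ
    | succ q ih => simpa [Nat.mul_succ] using W.cl_mul ih h2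
  have : d = 1 := by
    apply haper
    intro n hn hp
    have hc := W.cl_of_pos hδ hs n 1 hp
    rw [← Nat.mod_add_div n d] at hc
    have hc' := W.cl_cancel hc (mulc _)
    by_contra hnd
    have hpos : 1 ≤ n % d := Nat.one_le_iff_ne_zero.2 (fun h => hnd (Nat.dvd_of_mod_eq_zero h))
    exact Nat.find_min ex (Nat.mod_lt n h1) ⟨hpos, hc'⟩
  rwa [this] at h2

lemma Walk0.cl_all (W : Walk0 F μ ν) (hδ : ∀ n, 0 ≤ δ n) (hs : ∀ s ∈ F, Cl ν δ s 1)
    (haper : ∀ d : ℕ, (∀ n : ℕ, 1 ≤ n → 0 < ν n 1 → d ∣ n) → d = 1)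
    (hgen : Subgroup.closure (F : Set G) = ⊤) (x : G) : Cl ν δ x 0 := by
  have h1 := W.cl_one hδ hs haper
  have hx : x ∈ Subgroup.closure (F : Set G) := by rw [hgen]; trivial
  induction hx using Subgroup.closure_induction with
  | mem s hsF => exact W.cl_cancel (m := 0) (k := 1) (by simpa using hs s hsF) h1
  | one => exact W.cl_zero hδ
  | mul a b _ _ ha hb => exact W.cl_mul ha hb
  | inv a _ ha => exact W.cl_inv ha

lemma Walk0.word (W : Walk0 F μ ν) (hδ : ∀ n, 0 ≤ δ n) (hall : ∀ x, Cl ν δ x 0) (S : Finset G)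
    (hSgen : Subgroup.closure (S : Set G) = ⊤) : ∃ C : ℝ, 0 ≤ C ∧ ∀ n x,
    l1d (rtr x (ν n)) (ν n) ≤ C * wordLength (S : Set G) x * δ n := by
  choose C hC h using hall
  refine ⟨∑ s ∈ S, (C s + C s⁻¹), Finset.sum_nonneg fun s _ => add_nonneg (hC _) (hC _),
    fun n x => ?_⟩
  set K := ∑ s ∈ S, (C s + C s⁻¹)
  have hK : ∀ s ∈ S, C s + C s⁻¹ ≤ K := fun s hs =>
    Finset.single_le_sum (f := fun s => C s + C s⁻¹) (fun s _ => add_nonneg (hC _) (hC _)) hs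
  have hne : {k | ∃ l : List G, l.length = k ∧ (∀ x ∈ l, x ∈ (S : Set G) ∨ x⁻¹ ∈ (S : Set G)) ∧
      l.prod = x}.Nonempty := by
    obtain ⟨l, hl, hp⟩ := Submonoid.exists_list_of_mem_closure
      (show x ∈ Submonoid.closure ((S : Set G) ∪ (S : Set G)⁻¹) by
        rw [← Subgroup.closure_toSubmonoid, hSgen]; trivial)
    exact ⟨l.length, l, rfl, hl, hp⟩
  obtain ⟨l, hlen, hl, hp⟩ := Nat.sInf_mem hne
  have hw : wordLength (S : Set G) x = l.length := hlen.symm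
  rw [hw, ← hp]
  clear hw hlen hp hne
  induction l with
  | nil => simp [rtr_one, l1d]
  | cons a l ih =>
    have ih' := ih (fun y hy => hl y (List.mem_cons_of_mem _ hy))
    have ha : C a ≤ K := by
      rcases hl a List.mem_cons_self with h | h
      · linarith [hK a h, hC a⁻¹]
      · have := hK _ h; rw [inv_inv] at this; linarith [hC a⁻¹]
    have t := l1d_triangle (fin_rtr l.prod (fin_rtr a (W.fin n))) (fin_rtr l.prod (W.fin n))
      (W.fin n)
    rw [l1d_rtr] at t
    rw [List.prod_cons, rtr_mul, List.length_cons]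
    push_cast
    have := h a n
    rw [add_zero] at this
    nlinarith [mul_le_mul_of_nonneg_right ha (hδ n)]

lemma Walk0.final (W : Walk0 F μ ν) (n : ℕ) (x : G) (ε : ℝ) (hε : 0 < ε)
    (h : l1d (rtr x (ν n)) (ν n) ≤ ε * ε) :
    ∃ V : Set G, 1 - ε ≤ measOf (ν n) V ∧ ∀ g ∈ V, (1 - ε) * ν n g ≤ ν n (g * x) ∧
      ν n (g * x) ≤ (1 + ε) * ν n g := by
  have h' : l1d (rtr x⁻¹ (ν n)) (ν n) ≤ ε * ε := by
    rw [← l1d_rtr x⁻¹, ← rtr_mul, mul_inv_cancel, rtr_one, l1d_comm] at h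
    exact h
  refine ⟨{g | |ν n (g * x) - ν n g| ≤ ε * ν n g}, ?_, ?_⟩
  · set V := {g | |ν n (g * x) - ν n g| ≤ ε * ν n g}
    have sm : Summable (ν n) := summable_of_hasFiniteSupport (W.fin n)
    have e : ∑' g : V, ν n g + ∑' g : ↑Vᶜ, ν n g = ∑' g, ν n g := (sm.subtype V).tsum_add_tsum_compl (sm.subtype Vᶜ)
    rw [W.sum] at e
    have key : ε * ∑' g : ↑Vᶜ, ν n g ≤ ε * ε := by
      refine le_trans ?_ h'
      rw [tsum_subtype Vᶜ (ν n), ← tsum_mul_left]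
      refine ((sm.indicator _).mul_left ε).tsum_le_tsum ?_ (aux_summ (fin_rtr _ (W.fin n)) (W.fin n))
      intro g
      by_cases hg : g ∈ Vᶜ
      · rw [Set.indicator_of_mem hg]
        simp only [rtr, inv_inv]
        exact (not_le.1 (show ¬ |ν n (g * x) - ν n g| ≤ ε * ν n g from hg)).le
      · rw [Set.indicator_of_notMem hg]; simp
    have := le_of_mul_le_mul_left key hε
    unfold measOf
    linarith
  · intro g hg
    have := abs_le.1 (show |ν n (g * x) - ν n g| ≤ ε * ν n g from hg)
    constructor <;> linarith [this.1, this.2]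
end W

/-- Let `μ` be a finitely supported aperiodic probability measure whose
support generates `G`, let `H(n)` be the entropy of `μ^{*n}`, and suppose
`f(n)·√(H(n+1) - H(n)) → 0`. Then the distributions of `(G, μ)` are individually almost
invariant on the scale `f(n)`. -/
theorem stmt5 {G : Type*} [Group G] [Countable G] (S : Finset G)
    (hSgen : Subgroup.closure (S : Set G) = ⊤)
    (μ : G → ℝ) (hμ0 : ∀ g, 0 ≤ μ g) (hμ1 : HasSum μ 1)
    (hfin : (Function.support μ).Finite)
    (hgen : Subgroup.closure (Function.support μ) = ⊤)
    (haper : ∀ d : ℕ, (∀ n : ℕ, 1 ≤ n → 0 < convPow μ n 1 → d ∣ n) → d = 1)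
    (f : ℕ → ℝ) (hf0 : ∀ n, 0 ≤ f n)
    (hlim : Tendsto (fun n => f n * Real.sqrt (entropyOf μ (n + 1) - entropyOf μ n))
      atTop (nhds 0)) :
    ∀ ε > (0 : ℝ), ∀ hseq : ℕ → G,
      (∀ n, (wordLength (S : Set G) (hseq n) : ℝ) ≤ f n) →
      ∃ N : ℕ, ∀ n ≥ N, ∃ V : Set G,
        1 - ε ≤ measOf (convPow μ n) V ∧
        ∀ g ∈ V, (1 - ε) * convPow μ n g ≤ convPow μ n (g * hseq n) ∧
          convPow μ n (g * hseq n) ≤ (1 + ε) * convPow μ n g := by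
  have W := walk0 μ hμ0 hμ1 hfin
  set δ : ℕ → ℝ := fun n => Real.sqrt (entropyOf μ (n + 1) - entropyOf μ n) with hδd
  have hδ : ∀ n, 0 ≤ δ n := fun n => Real.sqrt_nonneg _
  have hs : ∀ s ∈ hfin.toFinset, Cl (convPow μ) δ s 1 := fun s hs => W.step hs
  have hall := W.cl_all hδ hs haper (by simpa using hgen)
  obtain ⟨C, hC, hw⟩ := W.word hδ hall S hSgen
  intro ε hε hseq hlen
  have hev : ∀ᶠ n in atTop, f n * δ n < ε * ε / (C + 1) :=
    hlim.eventually (gt_mem_nhds (by positivity))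
  obtain ⟨N, hN⟩ := eventually_atTop.1 hev
  refine ⟨N, fun n hn => W.final n (hseq n) ε hε ?_⟩
  have h1 := hN n hn
  rw [lt_div_iff₀ (by positivity)] at h1
  have h2 := mul_le_mul_of_nonneg_right (hlen n) (hδ n)
  have h3 := mul_le_mul_of_nonneg_left h2 hC
  have h4 := mul_nonneg (hf0 n) (hδ n)
  have h5 := hw n (hseq n)
  nlinarith
end
end

section
/- Let G be a countable group, (μ_n) a sequence of probability measures on G, (Ω_n) a sequence of subsets of G, (α_n) a sequence of subsets of G with μ_n(α_n) → 1 as n → ∞, and let μ'_n be the conditional measure μ'_n(A) = μ_n(A ∩ α_n)/μ_n(α_n). Suppose that K ≥ 1, ε ∈ (0,1), and for every n there is a subset V_n ⊆ G with μ'_n(V_n) ≥ 1 − ε such that (1/K)·μ'_n(g) ≤ μ'_n(g·h) ≤ K·μ'_n(g) for all g ∈ V_n and h ∈ Ω_n. Then for every ε' > 0 there exists N such that for all n ≥ N there is a subset Ṽ_n ⊆ G with μ_n(Ṽ_n) ≥ 1 − ε − ε' and (1/(K(1+ε')))·μ_n(g) ≤ μ_n(g·h) ≤ K(1+ε')·μ_n(g)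 for all g ∈ Ṽ_n and h ∈ Ω_n. -/
noncomputable section
open Filter
open scoped Classical

/-- Conditional measure of `μ` given a subset `α`: `(μ | α)(g) = μ(g)/μ(α)` for `g ∈ α`,
and `0` otherwise. -/
def condMeas {G : Type*} (μ : G → ℝ) (α : Set G) : G → ℝ :=
  fun g => if g ∈ α then μ g / measOf μ α else 0

/-- (Conditioned measures and almost invariance.) If `μₙ(αₙ) → 1` and the
conditional measures `μ'ₙ = (μₙ | αₙ)` are `(K, ε)` almost invariant with respect to `Ωₙ`,
then for every `ε' > 0` and all large `n` the measures `μₙ` are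
`(K(1+ε'), ε + ε')` almost invariant with respect to `Ωₙ`. -/
theorem stmt6 {G : Type*} [Group G] [Countable G]
    (μ : ℕ → G → ℝ) (hμ0 : ∀ n g, 0 ≤ μ n g) (hμ1 : ∀ n, HasSum (μ n) 1)
    (Ω : ℕ → Set G) (α : ℕ → Set G)
    (htend : Tendsto (fun n => measOf (μ n) (α n)) atTop (nhds 1))
    (K ε : ℝ) (hK : 1 ≤ K) (hε0 : 0 < ε) (hε1 : ε < 1)
    (hV : ∀ n : ℕ, ∃ V : Set G,
      1 - ε ≤ measOf (condMeas (μ n) (α n)) V ∧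
      ∀ g ∈ V, ∀ h ∈ Ω n,
        (1 / K) * condMeas (μ n) (α n) g ≤ condMeas (μ n) (α n) (g * h) ∧
        condMeas (μ n) (α n) (g * h) ≤ K * condMeas (μ n) (α n) g) :
    ∀ ε' > (0 : ℝ), ∃ N : ℕ, ∀ n ≥ N, ∃ W : Set G,
      1 - ε - ε' ≤ measOf (μ n) W ∧
      ∀ g ∈ W, ∀ h ∈ Ω n,
        (1 / (K * (1 + ε'))) * μ n g ≤ μ n (g * h) ∧
        μ n (g * h) ≤ K * (1 + ε') * μ n g := by
  intro ε' hε'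
  have h1 : ∀ᶠ n in atTop, max 0 (1 - ε') < measOf (μ n) (α n) :=
    htend.eventually (lt_mem_nhds (by apply max_lt <;> linarith))
  obtain ⟨N, hN⟩ := eventually_atTop.1 h1
  refine ⟨N, fun n hn => ?_⟩
  have hm := hN n hn
  obtain ⟨V, hV1, hV2⟩ := hV n
  have hm0 : 0 < measOf (μ n) (α n) := lt_of_le_of_lt (le_max_left _ _) hm
  have hm1 : 1 - ε' < measOf (μ n) (α n) := lt_of_le_of_lt (le_max_right _ _) hm
  have key : measOf (μ n) {g | g ∈ V ∧ g ∈ α n ∧ 0 < μ n g} =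
      measOf (μ n) (α n) * measOf (condMeas (μ n) (α n)) V := by
    generalize hM : measOf (μ n) (α n) = m at *
    unfold measOf
    rw [tsum_subtype, tsum_subtype, ← tsum_mul_left]
    congr 1
    funext x
    by_cases hx : x ∈ V
    · by_cases hxa : x ∈ α n
      · rcases (hμ0 n x).lt_or_eq with h | h
        · simp [Set.indicator, hx, hxa, h, condMeas, hM]
          field_simp
        · simp [Set.indicator, hx, hxa, ← h, condMeas]
      · simp [Set.indicator, hx, hxa, condMeas]
    · simp [Set.indicator, hx]
  refine ⟨{g | g ∈ V ∧ g ∈ α n ∧ 0 < μ n g}, ?_, ?_⟩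
  · rw [key]
    nlinarith [mul_le_mul_of_nonneg_left hV1 hm0.le, mul_pos hε0 hε']
  · rintro g ⟨hgV, hga, hg⟩ h hh
    obtain ⟨ha, hb⟩ := hV2 g hgV h hh
    have hK0 : 0 < K := by linarith
    generalize hM : measOf (μ n) (α n) = m at *
    have hgh : g * h ∈ α n := by
      by_contra hc
      simp only [condMeas, hga, hc, if_true, if_false, hM] at ha
      have : 0 < 1 / K * (μ n g / m) := by positivity
      linarith
    simp only [condMeas, hga, hgh, if_true, hM] at ha hb
    rw [← mul_div_assoc, div_le_div_iff_of_pos_right hm0] at ha hb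
    constructor
    · refine le_trans ?_ ha
      gcongr
      nlinarith
    · refine hb.trans ?_
      gcongr
      nlinarith
end
end

section
/- Let G be a group generated by a finite set S and let μ be a non-degenerate aperiodic probability measure on G. Suppose that for every g ∈ G and every ε > 0, μ^{*n}({x ∈ G : |μ^{*n}(x·g) − μ^{*n}(x)| > ε·μ^{*n}(x)}) → 0 as n → ∞. Then there exists a function R : ℕ → ℕ with R(n) → ∞ such that the distributions of (G,μ) are almost invariant on the scale R(n): for every ε > 0 there exists N and, for each n ≥ N, a subset V_n ⊆ G with μ^{*n}(V_n) ≥ 1 − ε such that (1 − ε)·μ^{*n}(h) ≤ μ^{*n}(h·g) ≤ (1 + ε)·μ^{*n}(h) for every h ∈ V_n and every g ∈ G with l_S(g) ≤ R(n). -/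
noncomputable section
open Filter
open scoped Classical

theorem aux_conv {G : Type*} [Group G] (μ ν : G → ℝ) (h0 : ∀ g, 0 ≤ μ g) (h1 : HasSum μ 1)
    (k0 : ∀ g, 0 ≤ ν g) (k1 : HasSum ν 1) :
    (∀ g, 0 ≤ conv μ ν g) ∧ HasSum (conv μ ν) 1 := by
  refine ⟨fun g => tsum_nonneg fun h => mul_nonneg (h0 _) (k0 _), ?_⟩
  have hs : Summable (fun x : G × G => μ x.1 * ν x.2) :=
    h1.summable.mul_of_nonneg k1.summable h0 k0
  have hp : HasSum (fun x : G × G => μ x.1 * ν x.2) 1 := by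
    have := h1.mul k1 hs
    simpa using this
  let e : G × G ≃ G × G :=
    { toFun := fun x => (x.2, x.2⁻¹ * x.1)
      invFun := fun x => (x.1 * x.2, x.1)
      left_inv := fun x => by simp
      right_inv := fun x => by simp }
  have hq : HasSum (fun x : G × G => μ x.2 * ν (x.2⁻¹ * x.1)) 1 := by
    have := e.hasSum_iff.mpr hp
    exact this
  exact hq.prod_fiberwise fun g => (hq.summable.prod_factor g).hasSum

theorem aux_pow {G : Type*} [Group G] (μ : G → ℝ) (h0 : ∀ g, 0 ≤ μ g) (h1 : HasSum μ 1) (n : ℕ) :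
    (∀ g, 0 ≤ convPow μ n g) ∧ HasSum (convPow μ n) 1 := by
  induction n with
  | zero =>
    refine ⟨fun g => ?_, ?_⟩
    · simp only [convPow]; split_ifs <;> norm_num
    · exact hasSum_ite_eq (1 : G) (1 : ℝ)
  | succ n ih => exact aux_conv μ _ h0 h1 ih.1 ih.2

theorem aux_sphere {G : Type*} [Group G] (S : Finset G) (k : ℕ) :
    {g : G | ∃ l : List G, l.length = k ∧ (∀ x ∈ l, x ∈ (S : Set G) ∨ x⁻¹ ∈ (S : Set G)) ∧
      l.prod = g}.Finite := by
  induction k with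
  | zero =>
    refine (Set.finite_singleton (1 : G)).subset ?_
    rintro g ⟨l, hl, -, rfl⟩
    simp [List.length_eq_zero_iff.mp hl]
  | succ k ih =>
    have hT : {x : G | x ∈ (S : Set G) ∨ x⁻¹ ∈ (S : Set G)}.Finite := by
      refine (S.finite_toSet.union (S.finite_toSet.image (fun x => x⁻¹))).subset ?_
      rintro x (h | h)
      · exact Or.inl h
      · exact Or.inr ⟨x⁻¹, h, inv_inv x⟩
    refine (Set.Finite.image2 (fun a b : G => a * b) hT ih).subset ?_
    rintro g ⟨l, hl, hm, rfl⟩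
    cases l with
    | nil => simp at hl
    | cons a t =>
      refine ⟨a, hm a (by simp), t.prod, ⟨t, by simpa using hl, fun x hx => hm x (by simp [hx]), rfl⟩, by simp⟩

theorem aux_ball {G : Type*} [Group G] (S : Finset G)
    (hSgen : Subgroup.closure (S : Set G) = ⊤) (r : ℕ) :
    {g : G | wordLength (S : Set G) g ≤ r}.Finite := by
  refine ((Set.finite_Iic r).biUnion fun k _ => aux_sphere S k).subset ?_
  intro g hg
  refine Set.mem_biUnion (x := wordLength (S : Set G) g) hg ?_
  refine Nat.sInf_mem (s := {k | ∃ l : List G, l.length = k ∧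
    (∀ x ∈ l, x ∈ (S : Set G) ∨ x⁻¹ ∈ (S : Set G)) ∧ l.prod = g}) ?_
  have : g ∈ Subgroup.closure (S : Set G) := by rw [hSgen]; trivial
  rw [← Subgroup.mem_toSubmonoid, Subgroup.closure_toSubmonoid] at this
  obtain ⟨l, hl, hp⟩ := Submonoid.exists_list_of_mem_closure this
  exact ⟨l.length, l, rfl, fun x hx => by simpa using hl x hx, hp⟩

theorem aux_union {G : Type*} (p : G → ℝ) (h0 : ∀ g, 0 ≤ p g) (h1 : HasSum p 1)
    (B : Finset G) (A : G → Set G) :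
    1 ≤ measOf p {x | ∀ g ∈ B, x ∉ A g} + ∑ g ∈ B, measOf p (A g) := by
  unfold measOf
  simp only [tsum_subtype]
  rw [← Summable.tsum_finsetSum (fun g _ => h1.summable.indicator _),
    ← Summable.tsum_add (h1.summable.indicator _)
      (summable_sum fun g _ => h1.summable.indicator _), ← h1.tsum_eq]
  refine Summable.tsum_le_tsum (fun x => ?_) h1.summable
    ((h1.summable.indicator _).add (summable_sum fun g _ => h1.summable.indicator _))
  have hn : ∀ g ∈ B, 0 ≤ (A g).indicator p x := fun g _ => Set.indicator_nonneg (fun x _ => h0 x) x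
  by_cases hx : ∀ g ∈ B, x ∉ A g
  · rw [Set.indicator_of_mem (by exact hx)]
    linarith [Finset.sum_nonneg hn]
  · rw [Set.indicator_of_notMem (by exact hx)]
    push Not at hx
    obtain ⟨g, hg, hxg⟩ := hx
    have := Finset.single_le_sum hn hg
    rw [Set.indicator_of_mem hxg] at this
    linarith

/-- If for every `g ∈ G` and `ε > 0` the `μ^{*n}`-measure of
`{x : |μ^{*n}(x g) - μ^{*n}(x)| > ε μ^{*n}(x)}` tends to `0`, then there is a function
`R(n) → ∞` such that the distributions of `(G, μ)` are almost invariant on the scale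
`R(n)`. -/
theorem stmt8 {G : Type*} [Group G] [Countable G] (S : Finset G)
    (hSgen : Subgroup.closure (S : Set G) = ⊤)
    (μ : G → ℝ) (hμ0 : ∀ g, 0 ≤ μ g) (hμ1 : HasSum μ 1)
    (hnd : Subsemigroup.closure (Function.support μ) = ⊤)
    (haper : ∀ d : ℕ, (∀ n : ℕ, 1 ≤ n → 0 < convPow μ n 1 → d ∣ n) → d = 1)
    (hconv : ∀ g : G, ∀ ε > (0 : ℝ),
      Tendsto (fun n => measOf (convPow μ n)
          {x : G | ε * convPow μ n x < |convPow μ n (x * g) - convPow μ n x|})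
        atTop (nhds 0)) :
    ∃ R : ℕ → ℕ, Tendsto R atTop atTop ∧
      ∀ ε > (0 : ℝ), ∃ N : ℕ, ∀ n ≥ N, ∃ V : Set G,
        1 - ε ≤ measOf (convPow μ n) V ∧
        ∀ h ∈ V, ∀ g : G, wordLength (S : Set G) g ≤ R n →
          (1 - ε) * convPow μ n h ≤ convPow μ n (h * g) ∧
            convPow μ n (h * g) ≤ (1 + ε) * convPow μ n h := by
  have hB := aux_ball S hSgen
  have hN : ∀ k : ℕ, ∃ N : ℕ, ∀ n ≥ N, ∑ g ∈ (hB k).toFinset, measOf (convPow μ n)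
      {x : G | (1 / ((k : ℝ) + 1)) * convPow μ n x < |convPow μ n (x * g) - convPow μ n x|}
        < 1 / ((k : ℝ) + 1) := by
    intro k
    have hk : (0 : ℝ) < 1 / ((k : ℝ) + 1) := by positivity
    have := tendsto_finsetSum (hB k).toFinset (fun g _ => hconv g _ hk)
    rw [Finset.sum_const_zero] at this
    exact eventually_atTop.mp (this.eventually_lt_const hk)
  choose N hN using hN
  have hR : Tendsto (fun n => Nat.findGreatest (fun k => N k ≤ n) n) atTop atTop := by
    refine tendsto_atTop.mpr fun k => ?_
    filter_upwards [eventually_ge_atTop (max (N k) k)] with n hn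
    exact Nat.le_findGreatest (le_trans (le_max_right _ _) hn) (le_trans (le_max_left _ _) hn)
  refine ⟨_, hR, fun ε hε => ?_⟩
  obtain ⟨m, hm⟩ := exists_nat_one_div_lt hε
  obtain ⟨M, hM⟩ := eventually_atTop.mp (hR.eventually_ge_atTop m)
  refine ⟨max M (N 0), fun n hn => ?_⟩
  have hm' := hM n (le_trans (le_max_left _ _) hn)
  have hNn : N (Nat.findGreatest (fun k => N k ≤ n) n) ≤ n :=
    Nat.findGreatest_spec (P := fun k => N k ≤ n) (Nat.zero_le n) (le_trans (le_max_right _ _) hn)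
  beta_reduce at hm' ⊢
  generalize Nat.findGreatest (fun k => N k ≤ n) n = r at hm' hNn
  obtain ⟨p0, p1⟩ := aux_pow μ hμ0 hμ1 n
  have hlt := hN r n hNn
  have hre : 1 / ((r : ℝ) + 1) ≤ ε := (Nat.one_div_le_one_div hm').trans hm.le
  refine ⟨{x | ∀ g ∈ (hB r).toFinset, x ∉ {x : G | (1 / ((r : ℝ) + 1)) * convPow μ n x <
    |convPow μ n (x * g) - convPow μ n x|}}, ?_, ?_⟩
  · have := aux_union (convPow μ n) p0 p1 (hB r).toFinset (fun g =>
      {x : G | (1 / ((r : ℝ) + 1)) * convPow μ n x < |convPow μ n (x * g) - convPow μ n x|})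
    linarith
  · intro h hh g hg
    have h3 := hh g (by simpa using hg)
    simp only [Set.mem_ofPred_eq, not_lt] at h3
    have h4 := abs_le.mp (h3.trans (mul_le_mul_of_nonneg_right hre (p0 h)))
    constructor <;> linarith [h4.1, h4.2]
end
end

section
/- Let G be a group generated by a finite set S and let μ be a symmetric, non-degenerate, aperiodic probability measure on G. Suppose there exist c < 1 and N such that μ^{*(n+1)}(e) ≤ c·μ^{*n}(e) for all n ≥ N. Then for every K ≥ 1 there exist M ∈ ℕ and N₀ such that for every n ≥ N₀ there exists h ∈ G with l_S(h) ≤ M and μ^{*n}(h) ≤ (2/K)·μ^{*n}(e). -/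
noncomputable section
open Filter
open scoped Classical

theorem aux_bd {G : Type*} [Group G] (μ : G → ℝ) (hμ0 : ∀ g, 0 ≤ μ g) (hμ1 : HasSum μ 1) (n : ℕ) :
    ∀ g, 0 ≤ convPow μ n g ∧ convPow μ n g ≤ 1 := by
  induction n with
  | zero => intro g; simp only [convPow]; split_ifs <;> norm_num
  | succ n ih =>
    intro g
    simp only [convPow, conv]
    refine ⟨tsum_nonneg fun h => mul_nonneg (hμ0 h) (ih _).1, ?_⟩
    have hle : ∀ h, μ h * convPow μ n (h⁻¹ * g) ≤ μ h := fun h =>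
      mul_le_of_le_one_right (hμ0 h) (ih _).2
    have hs : Summable fun h => μ h * convPow μ n (h⁻¹ * g) :=
      Summable.of_nonneg_of_le (fun h => mul_nonneg (hμ0 h) (ih _).1) hle hμ1.summable
    calc _ ≤ ∑' h, μ h := hs.tsum_le_tsum hle hμ1.summable
      _ = 1 := hμ1.tsum_eq

theorem aux_fin {G : Type*} [Group G] (μ : G → ℝ) (hμ0 : ∀ g, 0 ≤ μ g) (hμ1 : HasSum μ 1) (k : ℕ) :
    ∀ (δ : ℝ), 0 < δ → δ < 1 → ∀ g : G, ∃ F : Finset G, ∀ (n : ℕ) (t : ℝ), 0 ≤ t →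
      (∀ h ∈ F, t ≤ convPow μ n h) → δ * t ≤ convPow μ (n + k) g := by
  induction k with
  | zero =>
    intro δ h0 h1 g
    refine ⟨{g}, fun n t ht h => ?_⟩
    have := h g (by simp)
    simp only [add_zero]
    nlinarith
  | succ k ih =>
    intro δ h0 h1 g
    have hq0 : 0 < Real.sqrt δ := Real.sqrt_pos.2 h0
    have hq1 : Real.sqrt δ < 1 := by rw [Real.sqrt_lt' one_pos]; simpa using h1
    have hqq := Real.mul_self_sqrt h0.le
    obtain ⟨A, hA⟩ := (hμ1.eventually_const_lt hq1).exists
    choose F hF using fun g => ih (Real.sqrt δ) hq0 hq1 g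
    refine ⟨A.biUnion fun h => F (h⁻¹ * g), fun n t ht h => ?_⟩
    have hb := aux_bd μ hμ0 hμ1 (n + k)
    have hs : Summable fun h => μ h * convPow μ (n + k) (h⁻¹ * g) :=
      Summable.of_nonneg_of_le (fun h => mul_nonneg (hμ0 h) (hb _).1)
        (fun h => mul_le_of_le_one_right (hμ0 h) (hb _).2) hμ1.summable
    have hst : 0 ≤ Real.sqrt δ * t := mul_nonneg hq0.le ht
    calc δ * t = Real.sqrt δ * (Real.sqrt δ * t) := by rw [← mul_assoc, hqq]
      _ ≤ (∑ a ∈ A, μ a) * (Real.sqrt δ * t) := mul_le_mul_of_nonneg_right hA.le hst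
      _ = ∑ a ∈ A, μ a * (Real.sqrt δ * t) := Finset.sum_mul _ _ _
      _ ≤ ∑ a ∈ A, μ a * convPow μ (n + k) (a⁻¹ * g) := by
        refine Finset.sum_le_sum fun a ha => mul_le_mul_of_nonneg_left ?_ (hμ0 a)
        exact hF _ n t ht fun x hx => h x (Finset.mem_biUnion.2 ⟨a, ha, hx⟩)
      _ ≤ ∑' a, μ a * convPow μ (n + k) (a⁻¹ * g) :=
        hs.sum_le_tsum _ fun a _ => mul_nonneg (hμ0 a) (hb _).1
      _ = convPow μ (n + (k + 1)) g := rfl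

/-- Let `μ` be a symmetric non-degenerate aperiodic probability measure on
`G` with `μ^{*(n+1)}(e) ≤ c μ^{*n}(e)` for some `c < 1` and all large `n`. Then for any
`K ≥ 1` there are `M` and `N₀` such that for every `n ≥ N₀` some `h` of word length at most
`M` satisfies `μ^{*n}(h) ≤ (2/K) μ^{*n}(e)`. -/
theorem stmt9 {G : Type*} [Group G] [Countable G] (S : Finset G)
    (hSgen : Subgroup.closure (S : Set G) = ⊤)
    (μ : G → ℝ) (hμ0 : ∀ g, 0 ≤ μ g) (hμ1 : HasSum μ 1)
    (hsym : ∀ g : G, μ g = μ g⁻¹)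
    (hnd : Subsemigroup.closure (Function.support μ) = ⊤)
    (haper : ∀ d : ℕ, (∀ n : ℕ, 1 ≤ n → 0 < convPow μ n 1 → d ∣ n) → d = 1)
    (c : ℝ) (hc : c < 1) (N : ℕ)
    (hdecay : ∀ n ≥ N, convPow μ (n + 1) 1 ≤ c * convPow μ n 1) :
    ∀ K ≥ (1 : ℝ), ∃ M : ℕ, ∃ N₀ : ℕ, ∀ n ≥ N₀, ∃ h : G,
      wordLength (S : Set G) h ≤ M ∧ convPow μ n h ≤ (2 / K) * convPow μ n 1 := by
  intro K hK
  have hK0 : 0 < K := by linarith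
  have hc0 : 0 ≤ max c 0 := le_max_right _ _
  obtain ⟨k, hk⟩ := exists_pow_lt_of_lt_one (inv_pos.2 hK0) (max_lt hc one_pos)
  obtain ⟨F, hF⟩ := aux_fin μ hμ0 hμ1 k (1 / 2) (by norm_num) (by norm_num) 1
  refine ⟨(insert 1 F).sup (wordLength (S : Set G)), N, fun n hn => ?_⟩
  by_contra! hcon
  have hcon' : ∀ h ∈ insert 1 F, 2 / K * convPow μ n 1 < convPow μ n h := fun h hh =>
    hcon h (Finset.le_sup hh)
  have ha0 := (aux_bd μ hμ0 hμ1 n 1).1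
  have hpos : 0 < convPow μ n 1 := by
    rcases ha0.eq_or_lt with h | h
    · have := hcon' 1 (Finset.mem_insert_self _ _)
      rw [← h] at this
      simp at this
    · exact h
  have h1 := hF n (2 / K * convPow μ n 1) (by positivity) fun h hh =>
    (hcon' h (Finset.mem_insert_of_mem hh)).le
  have h2 : ∀ j, convPow μ (n + j) 1 ≤ (max c 0) ^ j * convPow μ n 1 := by
    intro j
    induction j with
    | zero => simp
    | succ j ih =>
      calc convPow μ (n + j + 1) 1 ≤ c * convPow μ (n + j) 1 := hdecay _ (by omega)
        _ ≤ max c 0 * convPow μ (n + j) 1 :=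
          mul_le_mul_of_nonneg_right (le_max_left _ _) (aux_bd μ hμ0 hμ1 _ 1).1
        _ ≤ max c 0 * ((max c 0) ^ j * convPow μ n 1) := mul_le_mul_of_nonneg_left ih hc0
        _ = _ := by ring
  have h3 := mul_lt_mul_of_pos_right hk hpos
  have h4 : 1 / 2 * (2 / K * convPow μ n 1) = K⁻¹ * convPow μ n 1 := by field_simp
  linarith [h2 k]
end
end

section
/- Let G be a finitely generated virtually nilpotent group with finite generating set S, and let μ be a finitely supported, symmetric, non-degenerate, aperiodic probability measure on G. Let r : ℕ → ℝ≥0 satisfy r(n)/√n → 0 as n → ∞. Then the distributions of (G,μ) are almost invariant on the scale r(n): for every ε > 0 there exists N and, for each n ≥ N, a subset V_n ⊆ G with μ^{*n}(V_n) ≥ 1 − ε such that (1 − ε)·μ^{*n}(h) ≤ μ^{*n}(h·g) ≤ (1 + ε)·μ^{*n}(h) for every h ∈ V_n and every g ∈ G with l_S(g) ≤ r(n). -/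
noncomputable section
open Filter
open scoped Classical

section part1
open scoped Pointwise commutatorElement

section algebra
variable {G : Type*} [Group G]

/-- letters: iterated commutators with weights -/
inductive Ltr (X : Finset G) : ℕ → G → Prop
  | base {x : G} : x ∈ X → Ltr X 1 x
  | comm {i j : ℕ} {x y : G} : Ltr X i x → Ltr X j y → Ltr X (i + j) ⁅x, y⁆

/-- words in allowed letters with bounded mass -/
inductive Wd (ρ : ℝ) (A : ℕ → G → Prop) : ℝ → G → Prop
  | one {m : ℝ} : 0 ≤ m → Wd ρ A m 1
  | cons {k : ℕ} {y : G} {m : ℝ} {g : G} : A k y → Wd ρ A m g → Wd ρ A (m + ρ ^ k) (y * g)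

variable {ρ : ℝ} {A B E : ℕ → G → Prop}

theorem Wd.nonneg (hρ : 0 ≤ ρ) {m : ℝ} {g : G} (h : Wd ρ A m g) : 0 ≤ m := by
  induction h with
  | one h => exact h
  | cons _ _ ih => positivity

theorem Wd.mono {m m' : ℝ} {g : G} (h : Wd ρ A m g) (hm : m ≤ m') : Wd ρ A m' g := by
  induction h generalizing m' with
  | one h => exact .one (h.trans hm)
  | @cons k y m g hy _ ih =>
    have := Wd.cons hy (ih (m' := m' - ρ ^ k) (by linarith))
    simpa using this

theorem Wd.mono_set (hAB : ∀ k y, A k y → B k y) {m : ℝ} {g : G} (h : Wd ρ A m g) :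
    Wd ρ B m g := by
  induction h with
  | one h => exact .one h
  | cons hy _ ih => exact .cons (hAB _ _ hy) ih

theorem Wd.mul {m m' : ℝ} {g g' : G} (h : Wd ρ A m g) (h' : Wd ρ A m' g') :
    Wd ρ A (m + m') (g * g') := by
  induction h with
  | one h => simpa using h'.mono (by linarith)
  | @cons k y m g hy _ ih =>
    have := Wd.cons hy ih
    rw [mul_assoc]
    exact this.mono (by linarith)

theorem Wd.single {k : ℕ} {y : G} (h : A k y) : Wd ρ A (ρ ^ k) y := by
  have := Wd.cons h (Wd.one (ρ := ρ) le_rfl)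
  simpa using this

theorem Wd.inv (hA : ∀ k y, A k y → A k y⁻¹) {m : ℝ} {g : G} (h : Wd ρ A m g) :
    Wd ρ A m g⁻¹ := by
  induction h with
  | one h => simpa using Wd.one h
  | cons hy _ ih =>
    rw [mul_inv_rev]
    exact ih.mul (.single (hA _ _ hy))

theorem Wd.pow {k : ℕ} {y : G} (h : A k y) (n : ℕ) : Wd ρ A (n * ρ ^ k) (y ^ n) := by
  induction n with
  | zero => simpa using Wd.one (ρ := ρ) (A := A) le_rfl
  | succ n ih =>
    rw [pow_succ]
    exact (ih.mul (.single h)).mono (by push_cast; linarith)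

theorem Wd.conj_letter (hρ : 0 ≤ ρ) {p : ℕ} {x : G} (hx : ∀ k y, A k y → A (p + k) ⁅x, y⁆)
    {m : ℝ} {g : G} (h : Wd ρ A m g) : Wd ρ A (m * (1 + ρ ^ p)) (x * g * x⁻¹) := by
  induction h with
  | one h => simpa using Wd.one (ρ := ρ) (A := A) (mul_nonneg h (by positivity))
  | @cons k y m g hy _ ih =>
    have e : x * (y * g) * x⁻¹ = ⁅x, y⁆ * (y * (x * g * x⁻¹)) := by
      simp [commutatorElement_def, mul_assoc]
    rw [e]
    exact (Wd.cons (hx _ _ hy) (Wd.cons hy ih)).mono (by rw [pow_add]; linarith)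

theorem one_add_le_exp' (x : ℝ) : 1 + x ≤ Real.exp x := by
  rw [add_comm]; exact Real.add_one_le_exp x

theorem Wd.conj (hρ : 0 ≤ ρ) (hBA : ∀ p x k y, B p x → A k y → A (p + k) ⁅x, y⁆)
    {m m' : ℝ} {t g : G} (ht : Wd ρ B m' t) (h : Wd ρ A m g) :
    Wd ρ A (m * Real.exp m') (t * g * t⁻¹) := by
  have hm := h.nonneg hρ
  induction ht with
  | @one m' h' =>
    simp only [one_mul, inv_one, mul_one]
    exact h.mono (le_mul_of_one_le_right hm (Real.one_le_exp h'))
  | @cons p x m' t hx _ ih =>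
    have := ih.conj_letter hρ (p := p) (x := x) (fun k y hy => hBA _ _ _ _ hx hy)
    have e : x * t * g * (x * t)⁻¹ = x * (t * g * t⁻¹) * x⁻¹ := by group
    rw [e]
    refine this.mono ?_
    rw [Real.exp_add, ← mul_assoc]
    exact mul_le_mul_of_nonneg_left (one_add_le_exp' _) (by positivity)

theorem Wd.comm_letter (hρ : 0 ≤ ρ) {p : ℕ} {x : G}
    (hBE : ∀ k y, B k y → E (p + k) ⁅x, y⁆)
    (hBE' : ∀ p x k y, B p x → E k y → E (p + k) ⁅x, y⁆)
    {m : ℝ} {v : G} (hv : Wd ρ B m v) :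
    Wd ρ E (ρ ^ p * (m * Real.exp m)) ⁅x, v⁆ := by
  induction hv with
  | @one m h => simpa using Wd.one (ρ := ρ) (A := E) (m := ρ ^ p * (m * Real.exp m)) (by positivity)
  | @cons k y m g hy h ih =>
    have hm := h.nonneg hρ
    have e : ⁅x, y * g⁆ = ⁅x, y⁆ * (y * ⁅x, g⁆ * y⁻¹) := by
      simp [commutatorElement_def, mul_assoc]
    rw [e]
    refine (Wd.mul (.single (hBE _ _ hy)) (ih.conj_letter hρ (p := k) (x := y)
      (fun k y h => hBE' _ _ _ _ hy h))).mono ?_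
    have h1 : m * Real.exp m * (1 + ρ ^ k) ≤ m * Real.exp (m + ρ ^ k) := by
      rw [Real.exp_add, ← mul_assoc]
      exact mul_le_mul_of_nonneg_left (one_add_le_exp' _) (by positivity)
    have h2 : ρ ^ k ≤ ρ ^ k * Real.exp (m + ρ ^ k) :=
      le_mul_of_one_le_right (by positivity) (Real.one_le_exp (by positivity))
    have h3 : ρ ^ k + m * Real.exp m * (1 + ρ ^ k) ≤ (m + ρ ^ k) * Real.exp (m + ρ ^ k) := by
      linarith
    calc _ = ρ ^ p * (ρ ^ k + m * Real.exp m * (1 + ρ ^ k)) := by rw [pow_add]; ring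
      _ ≤ _ := mul_le_mul_of_nonneg_left h3 (by positivity)

theorem Wd.comm (hρ : 0 ≤ ρ)
    (hAB : ∀ p x k y, A p x → B k y → E (p + k) ⁅x, y⁆)
    (hAE : ∀ p x k y, A p x → E k y → E (p + k) ⁅x, y⁆)
    (hBE : ∀ p x k y, B p x → E k y → E (p + k) ⁅x, y⁆)
    {m m' : ℝ} {u v : G} (hu : Wd ρ A m u) (hv : Wd ρ B m' v) :
    Wd ρ E ((m * Real.exp m) * (m' * Real.exp m')) ⁅u, v⁆ := by
  have hm' := hv.nonneg hρ
  set K := m' * Real.exp m' with hK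
  have hK0 : 0 ≤ K := by positivity
  induction hu with
  | @one m h => simpa using Wd.one (ρ := ρ) (A := E) (m := (m * Real.exp m) * K) (by positivity)
  | @cons p x m g hx h ih =>
    have hm := h.nonneg hρ
    have e : ⁅x * g, v⁆ = x * ⁅g, v⁆ * x⁻¹ * ⁅x, v⁆ := by
      simp [commutatorElement_def, mul_assoc]
    rw [e]
    refine (Wd.mul (ih.conj_letter hρ (p := p) (x := x) (fun k y h => hAE _ _ _ _ hx h))
      (hv.comm_letter hρ (fun k y h => hAB _ _ _ _ hx h) hBE)).mono ?_
    rw [← hK]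
    have h1 : m * Real.exp m * (1 + ρ ^ p) ≤ m * Real.exp (m + ρ ^ p) := by
      rw [Real.exp_add, ← mul_assoc]
      exact mul_le_mul_of_nonneg_left (one_add_le_exp' _) (by positivity)
    have h2 : ρ ^ p ≤ ρ ^ p * Real.exp (m + ρ ^ p) :=
      le_mul_of_one_le_right (by positivity) (Real.one_le_exp (by positivity))
    have h3 : ρ ^ p + m * Real.exp m * (1 + ρ ^ p) ≤ (m + ρ ^ p) * Real.exp (m + ρ ^ p) := by
      linarith
    calc _ = (ρ ^ p + m * Real.exp m * (1 + ρ ^ p)) * K := by ring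
      _ ≤ _ := mul_le_mul_of_nonneg_right h3 hK0

theorem Wd.extract (hρ : 0 ≤ ρ) {i : ℕ} {x : G} (hx : ∀ k y, A k y → A (i + k) ⁅x, y⁆)
    {m : ℝ} {g : G} (h : Wd ρ (fun k y => A k y ∨ (k = i ∧ y = x)) m g) :
    ∃ (a : ℕ) (u : G), g = u * x ^ a ∧ a * ρ ^ i ≤ m ∧ Wd ρ A (m * Real.exp (a * ρ ^ i)) u := by
  induction h with
  | @one m h => exact ⟨0, 1, by simp, by simpa using h, by simpa using Wd.one h⟩
  | @cons k y m g hy h ih =>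
    have hm := h.nonneg hρ
    obtain ⟨a, u, rfl, ha, hu⟩ := ih
    rcases hy with hy | ⟨rfl, rfl⟩
    · refine ⟨a, y * u, by group, by have : 0 ≤ ρ ^ k := by positivity
                                     linarith, (Wd.cons hy hu).mono ?_⟩
      have : ρ ^ k ≤ ρ ^ k * Real.exp (a * ρ ^ i) :=
        le_mul_of_one_le_right (by positivity) (Real.one_le_exp (by positivity))
      linarith
    · refine ⟨a + 1, y * u * y⁻¹, by rw [pow_succ']; group, by push_cast; linarith,
        (hu.conj_letter hρ hx).mono ?_⟩
      have h1 : m * Real.exp (a * ρ ^ k) * (1 + ρ ^ k) ≤ m * Real.exp (a * ρ ^ k + ρ ^ k) := by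
        rw [Real.exp_add, ← mul_assoc]
        exact mul_le_mul_of_nonneg_left (one_add_le_exp' _) (by positivity)
      have h2 : 0 ≤ ρ ^ k * Real.exp (a * ρ ^ k + ρ ^ k) := by positivity
      have h3 : ((a + 1 : ℕ) : ℝ) * ρ ^ k = a * ρ ^ k + ρ ^ k := by push_cast; ring
      rw [h3]; linarith

/-- letters of weight at least `i` -/
def Lev (X : Finset G) (i : ℕ) (k : ℕ) (y : G) : Prop := i ≤ k ∧ Ltr X k y

variable {X : Finset G}

theorem Lev.comm {i j k p q : ℕ} {x y : G} (hx : Lev X i p x) (hy : Lev X j q y) (h : k ≤ i + j) :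
    Lev X k (p + q) ⁅x, y⁆ := ⟨h.trans (add_le_add hx.1 hy.1), hx.2.comm hy.2⟩

theorem Ltr.inv (hX : ∀ x ∈ X, x⁻¹ ∈ X) {k : ℕ} {y : G} (h : Ltr X k y) : Ltr X k y⁻¹ := by
  cases h with
  | base h => exact .base (hX _ h)
  | comm h1 h2 =>
    rw [commutatorElement_inv, add_comm]
    exact .comm h2 h1

theorem Lev.inv (hX : ∀ x ∈ X, x⁻¹ ∈ X) {i k : ℕ} {y : G} (h : Lev X i k y) : Lev X i k y⁻¹ :=
  ⟨h.1, h.2.inv hX⟩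

theorem Ltr.pos {k : ℕ} {y : G} (h : Ltr X k y) : 1 ≤ k := by
  induction h with
  | base h => exact le_rfl
  | comm h1 h2 _ _ => omega

theorem Wd.of_ball {n : ℕ} {t : G} (ht : t ∈ X ^ n) : Wd ρ (Lev X 1) (n * ρ) t := by
  induction n generalizing t with
  | zero =>
    simp only [pow_zero, Finset.mem_one] at ht
    subst ht
    simpa using Wd.one (ρ := ρ) (A := Lev X 1) le_rfl
  | succ n ih =>
    rw [pow_succ, Finset.mem_mul] at ht
    obtain ⟨a, ha, b, hb, rfl⟩ := ht
    refine ((ih ha).mul (.single (k := 1) ⟨le_rfl, .base hb⟩)).mono ?_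
    push_cast; linarith

end algebra
end part1

section part2
open scoped Pointwise commutatorElement

section algebra
variable {G : Type*} [Group G] {X : Finset G} {ρ : ℝ}

theorem commPow_aux1 (hρ : 0 ≤ ρ) (hρ1 : ρ ≤ 1) {p q : ℕ} {y z : G} (hy : Ltr X p y)
    (hz : Ltr X q z) (b : ℕ) (hb : b * ρ ^ p ≤ 1) :
    ∃ e, y ^ b * z * (y ^ b)⁻¹ = e * ⁅y, z⁆ ^ b * z ∧
      Wd ρ (Lev X (p + q + 1)) (b * ρ ^ (p + q) * Real.exp 1 * Real.exp (b * ρ ^ p)) e := by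
  have hp := hy.pos
  have hq := hz.pos
  induction b with
  | zero => exact ⟨1, by simp, by simpa using Wd.one (ρ := ρ) (A := Lev X (p + q + 1)) le_rfl⟩
  | succ b ih =>
    have hpp : 0 ≤ ρ ^ p := by positivity
    have hii : 0 ≤ ρ ^ (p + q) := by positivity
    have hb' : (b : ℝ) * ρ ^ p ≤ 1 := by push_cast at hb; linarith
    obtain ⟨e, he, hW⟩ := ih hb'
    set x := ⁅y, z⁆ with hx
    have hxl : Ltr X (p + q) x := hy.comm hz
    refine ⟨(y * e * y⁻¹) * ⁅y, x ^ b⁆, ?_, ?_⟩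
    · calc y ^ (b + 1) * z * (y ^ (b + 1))⁻¹ = y * (y ^ b * z * (y ^ b)⁻¹) * y⁻¹ := by
            rw [pow_succ']; group
        _ = y * (e * x ^ b * z) * y⁻¹ := by rw [he]
        _ = (y * e * y⁻¹) * ⁅y, x ^ b⁆ * x ^ b * (y * z * y⁻¹) := by
            simp [commutatorElement_def, mul_assoc]
        _ = _ := by
            rw [pow_succ, hx]
            have : y * z * y⁻¹ = ⁅y, z⁆ * z := by simp [commutatorElement_def, mul_assoc]
            rw [this]; simp [mul_assoc]
    · have h1 := hW.conj_letter hρ (p := p) (x := y)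
        (fun k w hw => Lev.comm (i := p) ⟨le_rfl, hy⟩ hw (by omega))
      have h2 : Wd ρ (Lev X (p + q)) (b * ρ ^ (p + q)) (x ^ b) := Wd.pow ⟨le_rfl, hxl⟩ b
      have h3 := h2.comm_letter hρ (p := p) (x := y) (E := Lev X (p + q + 1))
        (fun k w hw => Lev.comm (i := p) ⟨le_rfl, hy⟩ hw (by omega))
        (fun k w k' w' hw hw' => Lev.comm hw hw' (by omega))
      refine (h1.mul h3).mono ?_
      have hbi : (b : ℝ) * ρ ^ (p + q) ≤ 1 := by
        refine le_trans ?_ hb'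
        exact mul_le_mul_of_nonneg_left (pow_le_pow_of_le_one hρ hρ1 (by omega)) (by positivity)
      have k1 : ρ ^ p * (b * ρ ^ (p + q) * Real.exp (b * ρ ^ (p + q)))
          ≤ ρ ^ (p + q) * Real.exp 1 := by
        calc _ = (b * ρ ^ p) * (ρ ^ (p + q) * Real.exp (b * ρ ^ (p + q))) := by ring
          _ ≤ 1 * (ρ ^ (p + q) * Real.exp 1) := by gcongr
          _ = _ := one_mul _
      have k2 : Real.exp (b * ρ ^ p) * (1 + ρ ^ p) ≤ Real.exp ((b + 1 : ℕ) * ρ ^ p) := by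
        have : ((b + 1 : ℕ) : ℝ) * ρ ^ p = b * ρ ^ p + ρ ^ p := by push_cast; ring
        rw [this, Real.exp_add]
        exact mul_le_mul_of_nonneg_left (one_add_le_exp' _) (by positivity)
      have k3 : (1 : ℝ) ≤ Real.exp ((b + 1 : ℕ) * ρ ^ p) := Real.one_le_exp (by positivity)
      calc _ ≤ b * ρ ^ (p + q) * Real.exp 1 * (Real.exp (b * ρ ^ p) * (1 + ρ ^ p))
              + ρ ^ (p + q) * Real.exp 1 * 1 := by linarith
        _ ≤ b * ρ ^ (p + q) * Real.exp 1 * Real.exp ((b + 1 : ℕ) * ρ ^ p)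
              + ρ ^ (p + q) * Real.exp 1 * Real.exp ((b + 1 : ℕ) * ρ ^ p) := by gcongr
        _ = _ := by push_cast; ring

theorem commPow_aux2 (hρ : 0 ≤ ρ) (hρ1 : ρ ≤ 1) {p q : ℕ} {y z : G} (hy : Ltr X p y)
    (hz : Ltr X q z) (b : ℕ) (hb : b * ρ ^ p ≤ 1) (d : ℕ) (hd : d * ρ ^ q ≤ 1) :
    ∃ e, y ^ b * z ^ d * (y ^ b)⁻¹ = e * ⁅y, z⁆ ^ (b * d) * z ^ d ∧
      Wd ρ (Lev X (p + q + 1)) (2 * Real.exp 2 * (d * ρ ^ q) * Real.exp (2 * (d * ρ ^ q))) e := by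
  have hp := hy.pos
  have hq := hz.pos
  obtain ⟨e₀, he₀, hW₀⟩ := commPow_aux1 hρ hρ1 hy hz b hb
  have hqq : 0 ≤ ρ ^ q := by positivity
  have hppp : 0 ≤ ρ ^ p := by positivity
  have hbi : (b : ℝ) * ρ ^ (p + q) ≤ ρ ^ q := by
    rw [pow_add, ← mul_assoc]
    exact mul_le_of_le_one_left hqq hb
  have hW₁ : Wd ρ (Lev X (p + q + 1)) (Real.exp 2 * ρ ^ q) e₀ := by
    refine hW₀.mono ?_
    calc _ ≤ ρ ^ q * Real.exp 1 * Real.exp 1 := by gcongr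
      _ = ρ ^ q * Real.exp (1 + 1) := by rw [Real.exp_add, mul_assoc]
      _ = _ := by norm_num [mul_comm]
  induction d with
  | zero => exact ⟨1, by simp, by simpa using Wd.one (ρ := ρ) (A := Lev X (p + q + 1)) le_rfl⟩
  | succ d ih =>
    have hd' : (d : ℝ) * ρ ^ q ≤ 1 := by push_cast at hd; linarith
    obtain ⟨e, he, hW⟩ := ih hd'
    set x := ⁅y, z⁆ with hx
    have hxl : Ltr X (p + q) x := hy.comm hz
    refine ⟨e₀ * (x ^ b * ((z * e * z⁻¹) * ⁅z, x ^ (b * d)⁆) * (x ^ b)⁻¹), ?_, ?_⟩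
    · calc y ^ b * z ^ (d + 1) * (y ^ b)⁻¹
            = (y ^ b * z * (y ^ b)⁻¹) * (y ^ b * z ^ d * (y ^ b)⁻¹) := by
            rw [pow_succ' z d]; group
        _ = (e₀ * x ^ b * z) * (e * x ^ (b * d) * z ^ d) := by rw [he, he₀]
        _ = e₀ * (x ^ b * ((z * e * z⁻¹) * ⁅z, x ^ (b * d)⁆) * (x ^ b)⁻¹)
              * (x ^ b * x ^ (b * d)) * (z * z ^ d) := by
            simp [commutatorElement_def, mul_assoc]
        _ = _ := by
            rw [← pow_add, ← pow_succ', mul_add, mul_one, add_comm b]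
    · have h1 := hW.conj_letter hρ (p := q) (x := z)
        (fun k w hw => Lev.comm (i := q) ⟨le_rfl, hz⟩ hw (by omega))
      have h2 : Wd ρ (Lev X (p + q)) ((b * d : ℕ) * ρ ^ (p + q)) (x ^ (b * d)) :=
        Wd.pow ⟨le_rfl, hxl⟩ _
      have h3 := h2.comm_letter hρ (p := q) (x := z) (E := Lev X (p + q + 1))
        (fun k w hw => Lev.comm (i := q) ⟨le_rfl, hz⟩ hw (by omega))
        (fun k w k' w' hw hw' => Lev.comm hw hw' (by omega))
      have h4 : Wd ρ (Lev X (p + q)) (b * ρ ^ (p + q)) (x ^ b) := Wd.pow ⟨le_rfl, hxl⟩ b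
      have h5 := h4.conj hρ (fun k w k' w' hw hw' => Lev.comm hw hw' (by omega)) (h1.mul h3)
      refine (hW₁.mul h5).mono ?_
      set s := ρ ^ q with hs
      set D := (d : ℝ) * s with hD
      have hD0 : 0 ≤ D := by positivity
      have hbd : ((b * d : ℕ) : ℝ) * ρ ^ (p + q) ≤ 1 := by
        calc ((b * d : ℕ) : ℝ) * ρ ^ (p + q) = d * (b * ρ ^ (p + q)) := by push_cast; ring
          _ ≤ d * s := by gcongr
          _ ≤ 1 := hd'
      have e1 : ((d + 1 : ℕ) : ℝ) * s = D + s := by push_cast; ring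
      rw [e1]
      have k1 : s * ((b * d : ℕ) * ρ ^ (p + q) * Real.exp ((b * d : ℕ) * ρ ^ (p + q)))
          ≤ s * Real.exp 1 := by
        calc _ ≤ s * (1 * Real.exp 1) := by gcongr
          _ = _ := by ring
      have hs1 : s ≤ 1 := pow_le_one₀ hρ hρ1
      have k4 : Real.exp 1 * Real.exp s ≤ Real.exp 2 := by
        rw [← Real.exp_add]; exact Real.exp_le_exp.2 (by linarith)
      have k5 : Real.exp (2 * D) * (1 + s) * Real.exp s ≤ Real.exp (2 * (D + s)) := by
        have : Real.exp (2 * (D + s)) = Real.exp (2 * D) * Real.exp s * Real.exp s := by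
          rw [← Real.exp_add, ← Real.exp_add]; ring_nf
        rw [this]
        gcongr
        exact one_add_le_exp' s
      have k6 : (1 : ℝ) ≤ Real.exp (2 * (D + s)) := Real.one_le_exp (by positivity)
      calc _ ≤ Real.exp 2 * s + (2 * Real.exp 2 * D * Real.exp (2 * D) * (1 + s)
                + s * Real.exp 1) * Real.exp s := by gcongr
        _ = Real.exp 2 * s + 2 * Real.exp 2 * D * (Real.exp (2 * D) * (1 + s) * Real.exp s)
                + s * (Real.exp 1 * Real.exp s) := by ring
        _ ≤ Real.exp 2 * s + 2 * Real.exp 2 * D * Real.exp (2 * (D + s))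
                + s * Real.exp 2 := by gcongr
        _ = 2 * Real.exp 2 * s * 1 + 2 * Real.exp 2 * D * Real.exp (2 * (D + s)) := by ring
        _ ≤ 2 * Real.exp 2 * s * Real.exp (2 * (D + s))
              + 2 * Real.exp 2 * D * Real.exp (2 * (D + s)) := by gcongr
        _ = _ := by ring

theorem commPow (hρ : 0 ≤ ρ) (hρ1 : ρ ≤ 1) {p q : ℕ} {y z : G} (hy : Ltr X p y)
    (hz : Ltr X q z) (b : ℕ) (hb : b * ρ ^ p ≤ 1) (d : ℕ) (hd : d * ρ ^ q ≤ 1) :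
    Wd ρ (Lev X (p + q + 1)) (2 * Real.exp 2 * Real.exp 2)
      (⁅y ^ b, z ^ d⁆ * (⁅y, z⁆ ^ (b * d))⁻¹) := by
  obtain ⟨e, he, hW⟩ := commPow_aux2 hρ hρ1 hy hz b hb d hd
  have : ⁅y ^ b, z ^ d⁆ * (⁅y, z⁆ ^ (b * d))⁻¹ = e := by
    rw [commutatorElement_def, he]; group
  rw [this]
  refine hW.mono ?_
  have : (0 : ℝ) ≤ d * ρ ^ q := by positivity
  calc _ ≤ 2 * Real.exp 2 * 1 * Real.exp (2 * 1) := by gcongr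
    _ = _ := by ring_nf

end algebra
end part2

section part3
open scoped Pointwise commutatorElement

section algebra
variable {G : Type*} [Group G] {X : Finset G} {I : Type*} {R : I → ℕ}

def WS (X : Finset G) (R : I → ℕ) (i : ℕ) (f : I → G) : Prop :=
  ∃ M : ℝ, ∀ ι, Wd (1 / (R ι : ℝ)) (Lev X i) M (f ι)

def GS (X : Finset G) (R : I → ℕ) (f : I → G) : Prop :=
  ∃ C : ℕ, ∀ ι, f ι ∈ X ^ (C * R ι)

theorem WS.mul {i : ℕ} {f g : I → G} (hf : WS X R i f) (hg : WS X R i g) : WS X R i (f * g) := by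
  obtain ⟨M, hM⟩ := hf
  obtain ⟨M', hM'⟩ := hg
  exact ⟨M + M', fun ι => (hM ι).mul (hM' ι)⟩

theorem WS.inv (hX : ∀ x ∈ X, x⁻¹ ∈ X) {i : ℕ} {f : I → G} (hf : WS X R i f) :
    WS X R i f⁻¹ := by
  obtain ⟨M, hM⟩ := hf
  exact ⟨M, fun ι => (hM ι).inv (fun k y h => h.inv hX)⟩

theorem WS.anti {i j : ℕ} (hij : i ≤ j) {f : I → G} (hf : WS X R j f) : WS X R i f := by
  obtain ⟨M, hM⟩ := hf
  exact ⟨M, fun ι => (hM ι).mono_set (fun k y h => ⟨hij.trans h.1, h.2⟩)⟩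

theorem WS.comm {p q : ℕ} {f g : I → G} (hf : WS X R p f) (hg : WS X R q g) :
    WS X R (p + q) ⁅f, g⁆ := by
  obtain ⟨M, hM⟩ := hf
  obtain ⟨M', hM'⟩ := hg
  refine ⟨_, fun ι => (hM ι).comm (by positivity) ?_ ?_ ?_ (hM' ι)⟩
  · intro _ _ _ _ h h'; exact h.comm h' le_rfl
  · intro _ _ _ _ h h'; exact h.comm h' (by omega)
  · intro _ _ _ _ h h'; exact h.comm h' (by omega)

theorem WS.conj {p i : ℕ} {t f : I → G} (ht : WS X R p t) (hf : WS X R i f) :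
    WS X R i (t * f * t⁻¹) := by
  obtain ⟨M, hM⟩ := ht
  obtain ⟨M', hM'⟩ := hf
  refine ⟨_, fun ι => Wd.conj (by positivity) ?_ (hM ι) (hM' ι)⟩
  intro _ _ _ _ h h'; exact h.comm h' (by omega)

theorem GS.mul {f g : I → G} (hf : GS X R f) (hg : GS X R g) : GS X R (f * g) := by
  obtain ⟨M, hM⟩ := hf
  obtain ⟨M', hM'⟩ := hg
  refine ⟨M + M', fun ι => ?_⟩
  rw [add_mul, pow_add]
  exact Finset.mul_mem_mul (hM ι) (hM' ι)

theorem ball_inv (hX : ∀ x ∈ X, x⁻¹ ∈ X) {n : ℕ} {t : G} (ht : t ∈ X ^ n) : t⁻¹ ∈ X ^ n := by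
  induction n generalizing t with
  | zero => simpa using ht
  | succ n ih =>
    rw [pow_succ, Finset.mem_mul] at ht
    obtain ⟨a, ha, b, hb, rfl⟩ := ht
    rw [mul_inv_rev, pow_succ']
    exact Finset.mul_mem_mul (hX _ hb) (ih ha)

theorem GS.inv (hX : ∀ x ∈ X, x⁻¹ ∈ X) {f : I → G} (hf : GS X R f) : GS X R f⁻¹ := by
  obtain ⟨M, hM⟩ := hf
  exact ⟨M, fun ι => ball_inv hX (hM ι)⟩

theorem GS.WS (hR : ∀ ι, 1 ≤ R ι) {f : I → G} (hf : GS X R f) : WS X R 1 f := by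
  obtain ⟨C, hC⟩ := hf
  refine ⟨C, fun ι => (Wd.of_ball (hC ι)).mono (le_of_eq ?_)⟩
  have : (R ι : ℝ) ≠ 0 := by have := hR ι; positivity
  push_cast; field_simp

theorem WS.powLetter {p : ℕ} {y : G} (hR : ∀ ι, 1 ≤ R ι) (hy : Ltr X p y) (a : I → ℕ)
    (ha : ∀ ι, a ι ≤ R ι ^ p) : WS X R p (fun ι => y ^ a ι) := by
  refine ⟨1, fun ι => (Wd.pow ⟨le_rfl, hy⟩ (a ι)).mono ?_⟩
  have h1 : (0 : ℝ) < R ι := by have := hR ι; positivity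
  have h2 : (a ι : ℝ) ≤ (R ι : ℝ) ^ p := by exact_mod_cast ha ι
  rw [one_div, inv_pow, ← div_eq_mul_inv]
  exact (div_le_one (by positivity)).2 h2

theorem powLemma (hX : ∀ x ∈ X, x⁻¹ ∈ X) (h1X : (1 : G) ∈ X) (hR : ∀ ι, 1 ≤ R ι)
    {p : ℕ} {y : G} (hy : Ltr X p y) :
    ∀ a : I → ℕ, (∀ ι, a ι ≤ R ι ^ p) →
      ∃ e t : I → G, (fun ι => y ^ a ι) = e * t ∧ WS X R (p + 1) e ∧ GS X R t := by
  induction hy with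
  | @base x hx =>
    intro a ha
    refine ⟨1, fun ι => x ^ a ι, by simp, ⟨0, fun ι => .one le_rfl⟩, 1, fun ι => ?_⟩
    have : a ι ≤ 1 * R ι := by simpa using ha ι
    exact Finset.pow_subset_pow_right h1X this (Finset.pow_mem_pow hx)
  | @comm p q y z hy hz ihy ihz =>
    have hp := hy.pos
    have hq := hz.pos
    have sub : ∀ b d : I → ℕ, (∀ ι, b ι ≤ R ι ^ p) → (∀ ι, d ι ≤ R ι ^ q) →
        ∃ e t : I → G, (fun ι => ⁅y, z⁆ ^ (b ι * d ι)) = e * t ∧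
          WS X R (p + q + 1) e ∧ GS X R t := by
      intro b d hb hd
      obtain ⟨e1, t1, h1, he1, ht1⟩ := ihy b hb
      obtain ⟨e2, t2, h2, he2, ht2⟩ := ihz d hd
      have hyb := WS.powLetter hR hy b hb
      have hzd := WS.powLetter hR hz d hd
      have key : WS X R (p + q + 1)
          (⁅e1 * t1, e2 * t2⁆ * (fun ι => ⁅y, z⁆ ^ (b ι * d ι))⁻¹) := by
        rw [← h1, ← h2]
        refine ⟨2 * Real.exp 2 * Real.exp 2, fun ι => ?_⟩
        have hRι := hR ι
        have h1 : (0 : ℝ) < R ι := by positivity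
        refine commPow (by positivity) ?_ hy hz (b ι) ?_ (d ι) ?_
        · rw [div_le_one h1]; exact_mod_cast hRι
        · have h2 : (b ι : ℝ) ≤ (R ι : ℝ) ^ p := by exact_mod_cast hb ι
          rw [one_div, inv_pow, ← div_eq_mul_inv]
          exact (div_le_one (by positivity)).2 h2
        · have h2 : (d ι : ℝ) ≤ (R ι : ℝ) ^ q := by exact_mod_cast hd ι
          rw [one_div, inv_pow, ← div_eq_mul_inv]
          exact (div_le_one (by positivity)).2 h2
      set xf : I → G := fun ι => ⁅y, z⁆ ^ (b ι * d ι) with hxf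
      have ht1p : WS X R p t1 := by
        have : t1 = e1⁻¹ * (e1 * t1) := by group
        rw [this, ← h1]
        exact ((he1.anti (by omega)).inv hX).mul hyb
      set v := e2 * t2 with hv
      have hvq : WS X R q v := by rw [← h2]; exact hzd
      have ht2q : WS X R q t2 := by
        have : t2 = e2⁻¹ * v := by rw [hv]; group
        rw [this]
        exact ((he2.anti (by omega)).inv hX).mul hvq
      have hc1 : WS X R q ⁅t1, v⁆ := (ht1p.comm hvq).anti (by omega)
      have hc2 : WS X R p ⁅t1, t2⁆ := (ht1p.comm ht2q).anti (by omega)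
      refine ⟨(⁅e1 * t1, v⁆ * xf⁻¹)⁻¹ * (⁅e1, ⁅t1, v⁆⁆ * (⁅t1, v⁆ * ⁅e1, v⁆ * ⁅t1, v⁆⁻¹))
          * (⁅t1, e2⁆ * ⁅e2, ⁅t1, t2⁆⁆), ⁅t1, t2⁆, ?_, ?_, ?_⟩
      · have i1 : ⁅e1 * t1, v⁆ = ⁅e1, ⁅t1, v⁆⁆ * (⁅t1, v⁆ * ⁅e1, v⁆ * ⁅t1, v⁆⁻¹) * ⁅t1, v⁆ := by
          simp [commutatorElement_def, mul_assoc]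
        have i2 : ⁅t1, v⁆ = ⁅t1, e2⁆ * ⁅e2, ⁅t1, t2⁆⁆ * ⁅t1, t2⁆ := by
          simp [hv, commutatorElement_def, mul_assoc]
        have i3 : xf = (⁅e1 * t1, v⁆ * xf⁻¹)⁻¹ * ⁅e1 * t1, v⁆ := by group
        calc xf = (⁅e1 * t1, v⁆ * xf⁻¹)⁻¹ * ⁅e1 * t1, v⁆ := i3
          _ = (⁅e1 * t1, v⁆ * xf⁻¹)⁻¹ *
              (⁅e1, ⁅t1, v⁆⁆ * (⁅t1, v⁆ * ⁅e1, v⁆ * ⁅t1, v⁆⁻¹) * ⁅t1, v⁆) := by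
                rw [← i1]
          _ = (⁅e1 * t1, v⁆ * xf⁻¹)⁻¹ *
              (⁅e1, ⁅t1, v⁆⁆ * (⁅t1, v⁆ * ⁅e1, v⁆ * ⁅t1, v⁆⁻¹)) * ⁅t1, v⁆ := by
                simp only [mul_assoc]
          _ = (⁅e1 * t1, v⁆ * xf⁻¹)⁻¹ *
              (⁅e1, ⁅t1, v⁆⁆ * (⁅t1, v⁆ * ⁅e1, v⁆ * ⁅t1, v⁆⁻¹)) *
                (⁅t1, e2⁆ * ⁅e2, ⁅t1, t2⁆⁆ * ⁅t1, t2⁆) := by rw [← i2]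
          _ = _ := by simp only [mul_assoc]
      · refine ((key.inv hX).mul (WS.mul ?_ (hc1.conj ?_))).mul (WS.mul ?_ ?_)
        · exact (he1.comm hc1).anti (by omega)
        · exact (he1.comm hvq).anti (by omega)
        · exact (ht1p.comm he2).anti (by omega)
        · exact (he2.comm hc2).anti (by omega)
      · rw [commutatorElement_def]
        exact ((ht1.mul ht2).mul (ht1.inv hX)).mul (ht2.inv hX)
    intro a ha
    obtain ⟨e1, t1, h1, he1, ht1⟩ := sub (fun ι => a ι / R ι ^ q) (fun ι => R ι ^ q)
      (fun ι => by
        have := ha ι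
        rw [pow_add] at this
        exact Nat.div_le_of_le_mul (by rwa [mul_comm] at this)) (fun ι => le_rfl)
    obtain ⟨e2, t2, h2, he2, ht2⟩ := sub (fun ι => 1) (fun ι => a ι % R ι ^ q)
      (fun ι => Nat.one_le_pow _ _ (hR ι))
      (fun ι => (Nat.mod_lt _ (Nat.pow_pos (hR ι))).le)
    refine ⟨e1 * (t1 * e2 * t1⁻¹), t1 * t2, ?_, he1.mul ((ht1.WS hR).conj he2), ht1.mul ht2⟩
    have : (fun ι => ⁅y, z⁆ ^ a ι) = (e1 * t1) * (e2 * t2) := by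
      rw [← h1, ← h2]
      funext ι
      simp only [Pi.mul_apply, one_mul]
      rw [← pow_add, mul_comm, Nat.div_add_mod]
    rw [this]; group

theorem powLemma' (hX : ∀ x ∈ X, x⁻¹ ∈ X) (h1X : (1 : G) ∈ X)
    {p : ℕ} {y : G} (hy : Ltr X p y) :
    ∃ (C : ℕ) (M : ℝ), ∀ R : ℕ, 1 ≤ R → ∀ a : ℕ, a ≤ R ^ p →
      ∃ e t : G, y ^ a = e * t ∧ Wd (1 / (R : ℝ)) (Lev X (p + 1)) M e ∧ t ∈ X ^ (C * R) := by
  obtain ⟨e, t, h, ⟨M, hM⟩, ⟨C, hC⟩⟩ := powLemma (I := {z : ℕ × ℕ // 1 ≤ z.1 ∧ z.2 ≤ z.1 ^ p})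
    (R := fun z => z.1.1) hX h1X (fun ι => ι.2.1) hy (fun z => z.1.2) (fun ι => ι.2.2)
  refine ⟨C, M, fun R hR a ha => ⟨e ⟨(R, a), hR, ha⟩, t ⟨(R, a), hR, ha⟩, ?_, ?_, ?_⟩⟩
  · exact congrFun h ⟨(R, a), hR, ha⟩
  · exact hM ⟨(R, a), hR, ha⟩
  · exact hC ⟨(R, a), hR, ha⟩

end algebra
end part3

section part4
open scoped Pointwise commutatorElement

section algebra
variable {G : Type*} [Group G] {X : Finset G}

/-- covering property -/
def Cov (X : Finset G) (A : ℕ → G → Prop) : Prop :=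
  ∃ C₀ : ℕ, ∀ M : ℝ, ∃ C : ℕ, ∀ R : ℕ, 1 ≤ R → ∃ F : Finset G, F.card ≤ C ∧
    ∀ g, Wd (1 / (R : ℝ)) A M g → ∃ t ∈ X ^ (C₀ * R), ∃ f ∈ F, g = t * f

theorem Cov.mono {A B : ℕ → G → Prop} (h : Cov X B) (hAB : ∀ k y, A k y → B k y) : Cov X A := by
  obtain ⟨C₀, h⟩ := h
  refine ⟨C₀, fun M => ?_⟩
  obtain ⟨C, h⟩ := h M
  refine ⟨C, fun R hR => ?_⟩
  obtain ⟨F, hF, h⟩ := h R hR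
  exact ⟨F, hF, fun g hg => h g (hg.mono_set hAB)⟩

theorem Cov.triv {A : ℕ → G → Prop} (hA : ∀ k y, A k y → y = 1) : Cov X A := by
  refine ⟨0, fun M => ⟨1, fun R hR => ⟨{1}, by simp, fun g hg => ⟨1, by simp, 1, by simp, ?_⟩⟩⟩⟩
  rw [mul_one]
  induction hg with
  | one _ => rfl
  | cons hy _ ih => rw [hA _ _ hy, ih, mul_one]

theorem Cov.step (hX : ∀ x ∈ X, x⁻¹ ∈ X) (h1X : (1 : G) ∈ X) {A : ℕ → G → Prop} {i : ℕ} {x : G}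
    (hx : Ltr X i x)
    (hA1 : ∀ k y, Lev X (i + 1) k y → A k y) (hA2 : ∀ k y, A k y → Lev X i k y)
    (h : Cov X A) : Cov X (fun k y => A k y ∨ (k = i ∧ y = x)) := by
  have hxA : ∀ p x' k y, Ltr X p x' → A k y → A (p + k) ⁅x', y⁆ := by
    intro p x' k y hx' hy
    refine hA1 _ _ ⟨?_, hx'.comm (hA2 _ _ hy).2⟩
    have := (hA2 _ _ hy).1
    have := hx'.pos
    omega
  obtain ⟨C₀, h⟩ := h
  obtain ⟨C₁, M₁, hpow⟩ := powLemma' hX h1X hx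
  refine ⟨C₁ + C₀, fun M => ?_⟩
  obtain ⟨C, h⟩ := h ((M * Real.exp M + M₁) * Real.exp C₁)
  refine ⟨C * (⌊M⌋₊ + 1), fun R hR => ?_⟩
  obtain ⟨F, hF, h⟩ := h R hR
  have hR0 : (0 : ℝ) < R := by positivity
  have hρ : (0 : ℝ) ≤ 1 / (R : ℝ) := by positivity
  refine ⟨F * (Finset.range (⌊M⌋₊ + 1)).image (fun q => x ^ (q * R ^ i)), ?_, ?_⟩
  · refine Finset.card_mul_le.trans (Nat.mul_le_mul hF ?_)
    exact Finset.card_image_le.trans (by simp)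
  · intro g hg
    have hM := hg.nonneg hρ
    obtain ⟨a, u, rfl, ha, hu⟩ := hg.extract hρ (fun k y hy => hxA _ _ _ _ hx hy)
    obtain ⟨e, t, het, he, ht⟩ := hpow R hR (a % R ^ i) (Nat.mod_lt _ (Nat.pow_pos hR)).le
    have hu' := hu.mono (m' := M * Real.exp M) (by gcongr)
    have htl : Wd (1 / (R : ℝ)) (Lev X 1) C₁ t⁻¹ := by
      refine (Wd.of_ball (ball_inv hX ht)).mono (le_of_eq ?_)
      push_cast; field_simp
    have hc := Wd.conj hρ (fun p x' k y h1 h2 => hxA p x' k y h1.2 h2) htl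
      (hu'.mul (he.mono_set hA1))
    obtain ⟨t', ht', f, hf, htf⟩ := h _ hc
    refine ⟨t * t', ?_, f * x ^ ((a / R ^ i) * R ^ i), ?_, ?_⟩
    · rw [add_mul, pow_add]; exact Finset.mul_mem_mul ht ht'
    · refine Finset.mul_mem_mul hf (Finset.mem_image_of_mem _ ?_)
      rw [Finset.mem_range, Nat.lt_succ_iff]
      refine Nat.le_floor ?_
      refine Nat.cast_div_le.trans ?_
      rw [one_div, inv_pow, ← div_eq_mul_inv] at ha
      exact_mod_cast ha
    · have e1 : x ^ a = x ^ (a % R ^ i) * x ^ ((a / R ^ i) * R ^ i) := by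
        rw [← pow_add, mul_comm (a / _), Nat.mod_add_div]
      calc u * x ^ a = t * (t⁻¹ * (u * e) * t⁻¹⁻¹) * x ^ ((a / R ^ i) * R ^ i) := by
            rw [e1, het]; group
        _ = _ := by rw [htf]; group

theorem Ltr.finite (k : ℕ) : {y | Ltr X k y}.Finite := by
  induction k using Nat.strong_induction_on with
  | _ k ih =>
    have : {y | Ltr X k y} ⊆ (X : Set G) ∪ ⋃ i ∈ Finset.range k, ⋃ j ∈ Finset.range k,
        Set.image2 (fun x y => ⁅x, y⁆) {y | Ltr X i y} {y | Ltr X j y} := by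
      intro y hy
      cases hy with
      | base h => exact Or.inl h
      | @comm i j x y hx hy =>
        right
        have := hx.pos
        have := hy.pos
        simp only [Set.mem_iUnion]
        exact ⟨i, by simp; omega, j, by simp; omega, x, hx, y, hy, rfl⟩
    refine Set.Finite.subset ?_ this
    refine (Finset.finite_toSet X).union ?_
    refine Set.Finite.biUnion (Finset.finite_toSet _) fun i hi => ?_
    refine Set.Finite.biUnion (Finset.finite_toSet _) fun j hj => ?_
    exact Set.Finite.image2 _ (ih i (by simpa using hi)) (ih j (by simpa using hj))

theorem Cov.level (hX : ∀ x ∈ X, x⁻¹ ∈ X) (h1X : (1 : G) ∈ X) {i : ℕ}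
    (h : Cov X (Lev X (i + 1))) : Cov X (Lev X i) := by
  have key : ∀ T : Finset G, (∀ y ∈ T, Ltr X i y) →
      Cov X (fun k y => Lev X (i + 1) k y ∨ (k = i ∧ y ∈ T)) := by
    intro T
    induction T using Finset.induction_on with
    | empty => intro _; exact h.mono (by simp)
    | insert x T hx ih =>
      intro hT
      have h1 := ih (fun y hy => hT y (Finset.mem_insert_of_mem hy))
      have h2 := h1.step hX h1X (hT x (Finset.mem_insert_self _ _)) (fun k y hy => Or.inl hy)
        (by
          rintro k y (hy | ⟨rfl, hy⟩)
          · exact ⟨by have := hy.1; omega, hy.2⟩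
          · exact ⟨le_rfl, hT y (Finset.mem_insert_of_mem hy)⟩)
      refine h2.mono ?_
      rintro k y (hy | ⟨rfl, hy⟩)
      · exact Or.inl (Or.inl hy)
      · rcases Finset.mem_insert.1 hy with rfl | hy
        · exact Or.inr ⟨rfl, rfl⟩
        · exact Or.inl (Or.inr ⟨rfl, hy⟩)
  refine (key (Ltr.finite (X := X) i).toFinset (by simp)).mono ?_
  intro k y hy
  rcases Nat.lt_or_ge i k with h | h
  · exact Or.inl ⟨h, hy.2⟩
  · have : k = i := le_antisymm h hy.1
    subst this
    exact Or.inr ⟨rfl, by simpa using hy.2⟩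

theorem Ltr.mem_lcs {H : Subgroup G} (hXH : ∀ x ∈ X, x ∈ H) {k : ℕ} {y : G} (h : Ltr X k y) :
    y ∈ H.lowerCentralSeries (Nat.log 2 k) := by
  induction h with
  | base h => simpa using hXH _ h
  | @comm i j x y hx hy ihx ihy =>
    have hi := hx.pos
    have hj := hy.pos
    have hHx : x ∈ H := H.lowerCentralSeries_antitone (Nat.zero_le _) ihx
    have hHy : y ∈ H := H.lowerCentralSeries_antitone (Nat.zero_le _) ihy
    rcases le_total i j with hij | hij
    · have : Nat.log 2 (i + j) ≤ Nat.log 2 j + 1 := by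
        rw [← Nat.log_mul_base (by norm_num) (by omega)]
        exact Nat.log_mono_right (by omega)
      refine H.lowerCentralSeries_antitone this ?_
      rw [← inv_mem_iff, commutatorElement_inv]
      exact Subgroup.commutator_mem_commutator ihy hHx
    · have : Nat.log 2 (i + j) ≤ Nat.log 2 i + 1 := by
        rw [← Nat.log_mul_base (by norm_num) (by omega)]
        exact Nat.log_mono_right (by omega)
      refine H.lowerCentralSeries_antitone this ?_
      exact Subgroup.commutator_mem_commutator ihx hHy

theorem cov_nilp (hX : ∀ x ∈ X, x⁻¹ ∈ X) (h1X : (1 : G) ∈ X) {H : Subgroup G}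
    (hXH : ∀ x ∈ X, x ∈ H) (hH : Group.IsNilpotent H) :
    ∃ C₀ : ℕ, ∀ K : ℕ, ∃ C : ℕ, ∀ R : ℕ, 1 ≤ R →
      (X ^ (K * R)).card ≤ C * (X ^ (C₀ * R)).card := by
  obtain ⟨c, hc⟩ := (H.isNilpotent_iff_lowerCentralSeries).1 hH
  have h0 : Cov X (Lev X (2 ^ c)) := Cov.triv (by
    intro k y hy
    have h1 := hy.2.mem_lcs hXH
    have h2 : c ≤ Nat.log 2 k := Nat.le_log_of_pow_le (by norm_num) hy.1
    have h3 := H.lowerCentralSeries_antitone h2 h1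
    rw [hc] at h3
    simpa using h3)
  have h1 : ∀ j, j ≤ 2 ^ c → Cov X (Lev X (2 ^ c - j)) := by
    intro j
    induction j with
    | zero => intro _; exact h0
    | succ j ih =>
      intro hj
      have := ih (by omega)
      have e : 2 ^ c - j = (2 ^ c - (j + 1)) + 1 := by omega
      rw [e] at this
      exact this.level hX h1X
  have h2 : Cov X (Lev X 1) := (h1 (2 ^ c) le_rfl).mono (fun k y hy => ⟨by omega, hy.2⟩)
  obtain ⟨C₀, h⟩ := h2
  refine ⟨C₀, fun K => ?_⟩
  obtain ⟨C, h⟩ := h K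
  refine ⟨C, fun R hR => ?_⟩
  obtain ⟨F, hF, h⟩ := h R hR
  have : X ^ (K * R) ⊆ X ^ (C₀ * R) * F := by
    intro g hg
    have hR0 : (0 : ℝ) < R := by positivity
    obtain ⟨t, ht, f, hf, rfl⟩ := h g ((Wd.of_ball hg).mono (le_of_eq (by push_cast; field_simp)))
    exact Finset.mul_mem_mul ht hf
  calc _ ≤ (X ^ (C₀ * R) * F).card := Finset.card_le_card this
    _ ≤ (X ^ (C₀ * R)).card * F.card := Finset.card_mul_le
    _ ≤ _ := by rw [mul_comm]; exact Nat.mul_le_mul_right _ hF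

theorem exists_ball {U : Finset G} (hU : ∀ x ∈ U, x⁻¹ ∈ U) (h1U : (1 : G) ∈ U)
    (hgen : Subgroup.closure (U : Set G) = ⊤) (g : G) : ∃ n, g ∈ U ^ n := by
  have : g ∈ Subgroup.closure (U : Set G) := by rw [hgen]; trivial
  induction this using Subgroup.closure_induction with
  | mem x hx => exact ⟨1, by simpa using hx⟩
  | one => exact ⟨0, by simp⟩
  | mul x y _ _ hx hy =>
    obtain ⟨n, hn⟩ := hx
    obtain ⟨m, hm⟩ := hy
    exact ⟨n + m, by rw [pow_add]; exact Finset.mul_mem_mul hn hm⟩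
  | inv x _ hx =>
    obtain ⟨n, hn⟩ := hx
    exact ⟨n, ball_inv hU hn⟩

theorem doubling (hvn : ∃ H : Subgroup G, H.FiniteIndex ∧ Group.IsNilpotent H)
    {U : Finset G} (hU : ∀ x ∈ U, x⁻¹ ∈ U) (h1U : (1 : G) ∈ U)
    (hgen : Subgroup.closure (U : Set G) = ⊤) :
    ∀ K : ℕ, ∃ C : ℕ, ∀ R : ℕ, (U ^ (K * (R + 1))).card ≤ C * (U ^ R).card := by
  obtain ⟨H, hfi, hH⟩ := hvn
  -- transversal
  obtain ⟨T, h1T, hT⟩ : ∃ T : Finset G, (1 : G) ∈ T ∧ ∀ g : G, ∃ t ∈ T, g * t⁻¹ ∈ H := by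
    have : Finite (G ⧸ H) := inferInstance
    have := Fintype.ofFinite (G ⧸ H)
    refine ⟨insert 1 (Finset.univ.image (fun q : G ⧸ H => (Quotient.out q)⁻¹)), by simp,
      fun g => ⟨(Quotient.out (QuotientGroup.mk (g⁻¹) : G ⧸ H))⁻¹, ?_, ?_⟩⟩
    · refine Finset.mem_insert_of_mem (Finset.mem_image_of_mem _ (Finset.mem_univ _))
    · have h := QuotientGroup.out_eq' (QuotientGroup.mk (g⁻¹) : G ⧸ H)
      rw [QuotientGroup.eq] at h
      have h2 := H.inv_mem h
      simpa using h2
  set X : Finset G := (T * U * T⁻¹).filter (· ∈ H) with hXdef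
  have hXH : ∀ x ∈ X, x ∈ H := fun x hx => (Finset.mem_filter.1 hx).2
  have hXinv : ∀ x ∈ X, x⁻¹ ∈ X := by
    intro x hx
    obtain ⟨h1, h2⟩ := Finset.mem_filter.1 hx
    refine Finset.mem_filter.2 ⟨?_, H.inv_mem h2⟩
    obtain ⟨a, ha, t, ht, rfl⟩ := Finset.mem_mul.1 h1
    obtain ⟨s, hs, u, hu, rfl⟩ := Finset.mem_mul.1 ha
    have : (s * u * t)⁻¹ = t⁻¹ * u⁻¹ * s⁻¹ := by group
    rw [this]
    exact Finset.mul_mem_mul (Finset.mul_mem_mul (Finset.mem_inv'.1 ht) (hU _ hu))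
      (Finset.inv_mem_inv hs)
  have h1X : (1 : G) ∈ X := by
    refine Finset.mem_filter.2 ⟨?_, H.one_mem⟩
    have : (1 : G) = 1 * 1 * 1⁻¹ := by simp
    rw [this]
    exact Finset.mul_mem_mul (Finset.mul_mem_mul h1T h1U) (Finset.inv_mem_inv h1T)
  obtain ⟨C₀, hcov⟩ := cov_nilp hXinv h1X hXH hH
  have hUX : ∀ n, U ^ n ⊆ X ^ n * T := by
    intro n
    induction n with
    | zero => 
      simp only [pow_zero]
      intro g hg
      rw [Finset.mem_one] at hg
      subst hg
      simpa using h1T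
    | succ n ih =>
      intro g hg
      rw [pow_succ] at hg
      obtain ⟨a, ha, u, hu, rfl⟩ := Finset.mem_mul.1 hg
      obtain ⟨x, hx, t, ht, rfl⟩ := Finset.mem_mul.1 (ih ha)
      obtain ⟨t', ht', hh⟩ := hT (t * u)
      have : x * t * u = x * (t * u * t'⁻¹) * t' := by group
      rw [this, pow_succ]
      refine Finset.mul_mem_mul (Finset.mul_mem_mul hx (Finset.mem_filter.2 ⟨?_, hh⟩)) ht'
      exact Finset.mul_mem_mul (Finset.mul_mem_mul ht hu) (Finset.inv_mem_inv ht')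
  obtain ⟨m, hm⟩ : ∃ m, X ⊆ U ^ m := by
    choose f hf using exists_ball hU h1U hgen
    refine ⟨X.sup f, fun x hx => ?_⟩
    exact Finset.pow_subset_pow_right h1U (Finset.le_sup hx) (hf x)
  set C₁ := m * C₀ + 1 with hC₁
  have main : ∀ K : ℕ, ∃ C : ℕ, ∀ R : ℕ, 1 ≤ R →
      (U ^ (K * R)).card ≤ C * (U ^ (C₁ * R)).card := by
    intro K
    obtain ⟨C, hC⟩ := hcov K
    refine ⟨T.card * C, fun R hR => ?_⟩
    have h2 : X ^ (C₀ * R) ⊆ U ^ (C₁ * R) := by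
      refine (Finset.pow_subset_pow_left hm).trans ?_
      rw [← pow_mul]
      refine Finset.pow_subset_pow_right h1U ?_
      rw [hC₁]; nlinarith
    calc _ ≤ (X ^ (K * R) * T).card := Finset.card_le_card (hUX _)
      _ ≤ (X ^ (K * R)).card * T.card := Finset.card_mul_le
      _ ≤ (C * (X ^ (C₀ * R)).card) * T.card := Nat.mul_le_mul_right _ (hC R hR)
      _ ≤ (C * (U ^ (C₁ * R)).card) * T.card := by gcongr
      _ = _ := by ring
  intro K
  obtain ⟨C, hC⟩ := main (2 * K * C₁)
  refine ⟨max C ((U ^ (K * C₁)).card), fun R => ?_⟩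
  rcases Nat.lt_or_ge R C₁ with h | h
  · calc _ ≤ (U ^ (K * C₁)).card :=
          Finset.card_le_card (Finset.pow_subset_pow_right h1U (Nat.mul_le_mul_left _ h))
      _ ≤ max C ((U ^ (K * C₁)).card) * 1 := by rw [mul_one]; exact le_max_right _ _
      _ ≤ _ := by
        gcongr
        exact Finset.card_pos.2 ⟨1, Finset.one_mem_pow h1U⟩
  · have hC₁0 : 0 < C₁ := by omega
    have hq : 1 ≤ R / C₁ := (Nat.one_le_div_iff hC₁0).2 h
    have h1 : R + 1 ≤ 2 * C₁ * (R / C₁) := by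
      have := Nat.lt_mul_div_succ R hC₁0
      nlinarith
    calc _ ≤ (U ^ (2 * K * C₁ * (R / C₁))).card := by
          refine Finset.card_le_card (Finset.pow_subset_pow_right h1U ?_)
          calc _ ≤ K * (2 * C₁ * (R / C₁)) := Nat.mul_le_mul_left _ h1
            _ = _ := by ring
      _ ≤ C * (U ^ (C₁ * (R / C₁))).card := hC _ hq
      _ ≤ max C ((U ^ (K * C₁)).card) * (U ^ R).card := by
          refine Nat.mul_le_mul (le_max_left _ _) ?_
          exact Finset.card_le_card (Finset.pow_subset_pow_right h1U (Nat.mul_div_le _ _))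

end algebra
end part4

section part5
section hilb
open scoped RealInnerProductSpace

variable {G : Type*} [Group G] {E : Type*} [NormedAddCommGroup E] [InnerProductSpace ℝ E]

/-- averaging operator -/
def avg (τ : G →* (E ≃ₗᵢ[ℝ] E)) (A : Finset G) (μ : G → ℝ) (f : E) : E := ∑ g ∈ A, μ g • τ g f

/-- energy -/
def energy (τ : G →* (E ≃ₗᵢ[ℝ] E)) (A : Finset G) (μ : G → ℝ) (f : E) : ℝ :=
  ‖f‖ ^ 2 - ‖avg τ A μ f‖ ^ 2

lemma rep_mul (τ : G →* (E ≃ₗᵢ[ℝ] E)) (g h : G) (f : E) : τ (g * h) f = τ g (τ h f) := by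
  rw [map_mul]; rfl

lemma rep_inner (τ : G →* (E ≃ₗᵢ[ℝ] E)) (g : G) (f h : E) : ⟪τ g f, h⟫ = ⟪f, τ g⁻¹ h⟫ := by
  have : h = τ g (τ g⁻¹ h) := by
    rw [← rep_mul]; simp
  conv_lhs => rw [this]
  exact LinearIsometryEquiv.inner_map_map _ _ _

variable {τ : G →* (E ≃ₗᵢ[ℝ] E)} {A : Finset G} {μ : G → ℝ}

lemma avg_inner_left (f h : E) : ⟪avg τ A μ f, h⟫ = ∑ g ∈ A, μ g * ⟪τ g f, h⟫ := by
  simp [avg, sum_inner, real_inner_smul_left]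

lemma avg_symm (hA : ∀ g ∈ A, g⁻¹ ∈ A) (hs : ∀ g, μ g = μ g⁻¹) (f h : E) :
    ⟪avg τ A μ f, h⟫ = ⟪f, avg τ A μ h⟫ := by
  rw [avg_inner_left, real_inner_comm, avg_inner_left]
  refine Finset.sum_bij' (fun g _ => g⁻¹) (fun g _ => g⁻¹) hA hA (by simp) (by simp) ?_
  intro g hg
  rw [← hs, rep_inner, real_inner_comm]

lemma energy_eq (h1 : ∑ g ∈ A, μ g = 1) (f : E) :
    energy τ A μ f = (1 / 2) * ∑ g ∈ A, ∑ h ∈ A, μ g * μ h * ‖τ g f - τ h f‖ ^ 2 := by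
  have e1 : ∀ g h : G, ‖τ g f - τ h f‖ ^ 2 = 2 * ‖f‖ ^ 2 - 2 * ⟪τ g f, τ h f⟫ := by
    intro g h
    rw [norm_sub_sq_real]; simp; ring
  have e2 : ‖avg τ A μ f‖ ^ 2 = ∑ g ∈ A, ∑ h ∈ A, μ g * μ h * ⟪τ g f, τ h f⟫ := by
    rw [← real_inner_self_eq_norm_sq, avg_inner_left]
    refine Finset.sum_congr rfl fun g _ => ?_
    rw [real_inner_comm, avg_inner_left, Finset.mul_sum]
    refine Finset.sum_congr rfl fun h _ => ?_
    rw [real_inner_comm]; ring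
  have e3 : ‖f‖ ^ 2 = ∑ g ∈ A, ∑ h ∈ A, μ g * μ h * ‖f‖ ^ 2 := by
    simp_rw [← Finset.sum_mul, ← Finset.mul_sum, h1]; simp [h1]
  rw [energy, e2, e3, ← Finset.sum_sub_distrib, Finset.mul_sum]
  refine Finset.sum_congr rfl fun g _ => ?_
  rw [← Finset.sum_sub_distrib, Finset.mul_sum]
  refine Finset.sum_congr rfl fun h _ => ?_
  rw [e1]; ring

lemma energy_nonneg (h0 : ∀ g, 0 ≤ μ g) (h1 : ∑ g ∈ A, μ g = 1) (f : E) : 0 ≤ energy τ A μ f := by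
  rw [energy_eq h1]
  exact mul_nonneg (by norm_num) (Finset.sum_nonneg fun g _ => Finset.sum_nonneg fun h _ =>
    mul_nonneg (mul_nonneg (h0 _) (h0 _)) (sq_nonneg _))

lemma energy_ge (h0 : ∀ g, 0 ≤ μ g) (h1 : ∑ g ∈ A, μ g = 1) (f : E) {g h : G} (hg : g ∈ A)
    (hh : h ∈ A) : (1 / 2) * (μ g * μ h * ‖τ g f - τ h f‖ ^ 2) ≤ energy τ A μ f := by
  rw [energy_eq h1]
  have nn : ∀ g h : G, 0 ≤ μ g * μ h * ‖τ g f - τ h f‖ ^ 2 := fun g h => 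
    mul_nonneg (mul_nonneg (h0 _) (h0 _)) (sq_nonneg _)
  refine mul_le_mul_of_nonneg_left ?_ (by norm_num)
  refine le_trans ?_ (Finset.single_le_sum 
    (f := fun g => ∑ h ∈ A, μ g * μ h * ‖τ g f - τ h f‖ ^ 2)
    (fun g _ => Finset.sum_nonneg fun h _ => nn g h) hg)
  exact Finset.single_le_sum (f := fun h => μ g * μ h * ‖τ g f - τ h f‖ ^ 2) (fun h _ => nn g h) hh

lemma energy_anti (hA : ∀ g ∈ A, g⁻¹ ∈ A) (hs : ∀ g, μ g = μ g⁻¹) (f : E) :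
    energy τ A μ (avg τ A μ f) ≤ energy τ A μ f := by
  set P := avg τ A μ
  have h1 : ⟪f, P (P f)⟫ = ‖P f‖ ^ 2 := by
    rw [← avg_symm hA hs, real_inner_self_eq_norm_sq]
  have h2 := norm_sub_sq_real f (P (P f))
  have : 0 ≤ ‖f - P (P f)‖ ^ 2 := sq_nonneg _
  show ‖P f‖ ^ 2 - ‖P (P f)‖ ^ 2 ≤ ‖f‖ ^ 2 - ‖P f‖ ^ 2
  linarith

lemma energy_iter_anti (hA : ∀ g ∈ A, g⁻¹ ∈ A) (hs : ∀ g, μ g = μ g⁻¹) (f : E) :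
    Antitone fun k => energy τ A μ ((avg τ A μ)^[k] f) := by
  refine antitone_nat_of_succ_le fun k => ?_
  simp only [Function.iterate_succ_apply']
  exact energy_anti hA hs _

lemma norm_iter_sub (f : E) (k : ℕ) : ‖f‖ ^ 2 - ‖(avg τ A μ)^[k] f‖ ^ 2 
    = ∑ i ∈ Finset.range k, energy τ A μ ((avg τ A μ)^[i] f) := by
  induction k with
  | zero => simp
  | succ k ih => 
    rw [Finset.sum_range_succ, ← ih, Function.iterate_succ_apply', energy]; ring

/-- upper bound for the loss of norm -/
lemma norm_iter_sub_le (hA : ∀ g ∈ A, g⁻¹ ∈ A) (hs : ∀ g, μ g = μ g⁻¹) (f : E) (k : ℕ) :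
    ‖f‖ ^ 2 - ‖(avg τ A μ)^[k] f‖ ^ 2 ≤ k * energy τ A μ f := by
  rw [norm_iter_sub]
  refine (Finset.sum_le_card_nsmul _ _ (energy τ A μ f) ?_).trans (by simp)
  intro i _
  exact energy_iter_anti hA hs f (Nat.zero_le i)

/-- lower bound -/
lemma energy_iter_le (hA : ∀ g ∈ A, g⁻¹ ∈ A) (hs : ∀ g, μ g = μ g⁻¹) (f : E) (k : ℕ) :
    (k + 1) * energy τ A μ ((avg τ A μ)^[k] f) ≤ ‖f‖ ^ 2 := by
  have h := norm_iter_sub (τ := τ) (A := A) (μ := μ) f (k + 1)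
  have h2 : (k + 1) * energy τ A μ ((avg τ A μ)^[k] f) ≤ 
     ∑ i ∈ Finset.range (k + 1), energy τ A μ ((avg τ A μ)^[i] f) := by
    refine le_trans (by simp) (Finset.card_nsmul_le_sum _ _ (energy τ A μ ((avg τ A μ)^[k] f)) ?_)
    intro i hi
    exact energy_iter_anti hA hs f (by simp at hi; omega)
  nlinarith [sq_nonneg ‖(avg τ A μ)^[k+1] f‖]

/-- translation controlled by energy -/
def Good (τ : G →* (E ≃ₗᵢ[ℝ] E)) (A : Finset G) (μ : G → ℝ) (g : G) : Prop :=
  ∃ C : ℝ, 0 ≤ C ∧ ∀ f : E, ‖τ g f - f‖ ≤ C * Real.sqrt (energy τ A μ f)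

lemma tri (g h : G) (f : E) : ‖τ (g * h) f - f‖ ≤ ‖τ g f - f‖ + ‖τ h f - f‖ := by
  have : τ (g * h) f - f = τ g (τ h f - f) + (τ g f - f) := by rw [rep_mul, map_sub]; abel
  rw [this]
  refine (norm_add_le _ _).trans ?_
  rw [LinearIsometryEquiv.norm_map]; linarith

lemma Good.one : Good τ A μ 1 := ⟨0, le_rfl, fun f => by simp⟩

lemma Good.mul {g h : G} (hg : Good τ A μ g) (hh : Good τ A μ h) : Good τ A μ (g * h) := by
  obtain ⟨C, hC, hg⟩ := hg
  obtain ⟨D, hD, hh⟩ := hh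
  refine ⟨C + D, by positivity, fun f => (tri g h f).trans ?_⟩
  rw [add_mul]; exact add_le_add (hg f) (hh f)

lemma Good.pair (hA : ∀ g ∈ A, g⁻¹ ∈ A) (h0 : ∀ g, 0 ≤ μ g) (h1 : ∑ g ∈ A, μ g = 1)
    (hpos : ∀ g ∈ A, 0 < μ g) {g h : G} (hg : g ∈ A) (hh : h ∈ A) : Good τ A μ (g * h) := by
  have hg' := hA g hg
  have hc : 0 < μ g⁻¹ * μ h := mul_pos (hpos _ hg') (hpos _ hh)
  refine ⟨Real.sqrt (2 / (μ g⁻¹ * μ h)), Real.sqrt_nonneg _, fun f => ?_⟩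
  have e := energy_ge (τ := τ) h0 h1 f hg' hh
  have e2 : ‖τ (g * h) f - f‖ = ‖τ g⁻¹ f - τ h f‖ := by
    rw [← LinearIsometryEquiv.norm_map (τ g) (τ g⁻¹ f - τ h f), map_sub, ← rep_mul, ← rep_mul]
    simp [norm_sub_rev]
  rw [e2, ← Real.sqrt_mul (by positivity)]
  refine Real.le_sqrt_of_sq_le ?_
  rw [div_mul_eq_mul_div, le_div_iff₀ hc]
  linarith

lemma good_uniform (hgood : ∀ g : G, Good τ A μ g) (U : Finset G) :
    ∃ C : ℝ, 0 ≤ C ∧ ∀ g ∈ U, ∀ f : E, ‖τ g f - f‖ ≤ C * Real.sqrt (energy τ A μ f) := by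
  choose C hC h using hgood
  refine ⟨∑ g ∈ U, C g, Finset.sum_nonneg fun g _ => hC g, fun g hg f => (h g f).trans ?_⟩
  exact mul_le_mul_of_nonneg_right (Finset.single_le_sum (fun g _ => hC g) hg) (Real.sqrt_nonneg _)

open scoped Pointwise in
lemma good_pow {U : Finset G} {C : ℝ} 
    (h : ∀ g ∈ U, ∀ f : E, ‖τ g f - f‖ ≤ C * Real.sqrt (energy τ A μ f)) (k : ℕ) :
    ∀ g ∈ U ^ k, ∀ f : E, ‖τ g f - f‖ ≤ k * (C * Real.sqrt (energy τ A μ f)) := by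
  induction k with
  | zero => intro g hg f; simp at hg; simp [hg]
  | succ k ih =>
    intro g hg f
    rw [pow_succ] at hg
    obtain ⟨a, ha, b, hb, rfl⟩ := Finset.mem_mul.1 hg
    refine (tri a b f).trans ?_
    push_cast
    have := ih a ha f
    have := h b hb f
    linarith
end hilb
end part5

section part6
section conc
open scoped RealInnerProductSpace

/-- square summable functions -/
abbrev L2 (G : Type*) := lp (fun _ : G => ℝ) 2

variable {G : Type*} [Group G]

lemma memL2_of_fin {f : G → ℝ} (hf : (Function.support f).Finite) : Memℓp (E := fun _ : G => ℝ) f 2 := by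
  refine memℓp_gen (summable_of_hasFiniteSupport (hf.subset ?_))
  intro x hx h
  apply hx
  simp [h]

/-- vector from a finitely supported function -/
def toL2 (f : G → ℝ) (hf : (Function.support f).Finite) : L2 G := ⟨f, memL2_of_fin hf⟩

@[simp] lemma toL2_apply (f : G → ℝ) (hf) (x : G) : toL2 f hf x = f x := rfl

/-- right translation -/
def trFun (g : G) (f : L2 G) : L2 G := ⟨fun x => f (x * g), by
  have := lp.memℓp f
  rw [memℓp_gen_iff (by norm_num)] at this
  refine memℓp_gen ?_
  exact this.comp_injective (mul_left_injective g)⟩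

@[simp] lemma trFun_apply (g : G) (f : L2 G) (x : G) : trFun g f x = f (x * g) := rfl

lemma l2_inner (f h : L2 G) : ⟪f, h⟫ = ∑' x, f x * h x := by
  rw [lp.inner_eq_tsum]; congr 1; ext x; simp [mul_comm]

lemma l2_norm_sq (f : L2 G) : ‖f‖ ^ 2 = ∑' x, f x ^ 2 := by
  rw [← real_inner_self_eq_norm_sq, l2_inner]; simp only [sq]

lemma l2_summable (f : L2 G) : Summable fun x => f x ^ 2 := by
  have := lp.summable_inner (𝕜 := ℝ) f f
  simpa [sq] using this

lemma trFun_norm (g : G) (f : L2 G) : ‖trFun g f‖ = ‖f‖ := by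
  have : ‖trFun g f‖ ^ 2 = ‖f‖ ^ 2 := by
    rw [l2_norm_sq, l2_norm_sq]
    exact (Equiv.mulRight g).tsum_eq (fun x => f x ^ 2)
  exact (sq_eq_sq₀ (norm_nonneg _) (norm_nonneg _)).1 this

/-- right translation isometry -/
def trIso (g : G) : L2 G ≃ₗᵢ[ℝ] L2 G where
  toFun := trFun g
  invFun := trFun g⁻¹
  map_add' f h := by ext x; simp
  map_smul' c f := by ext x; simp
  left_inv f := by ext x; simp
  right_inv f := by ext x; simp
  norm_map' f := trFun_norm g f

/-- right regular representation -/
def reg (G : Type*) [Group G] : G →* (L2 G ≃ₗᵢ[ℝ] L2 G) where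
  toFun := trIso
  map_one' := by ext f x; show trFun 1 f x = f x; simp
  map_mul' g h := by
    ext f x; show trFun (g * h) f x = trFun g (trFun h f) x; simp [mul_assoc]

@[simp] lemma reg_apply (g : G) (f : L2 G) (x : G) : reg G g f x = f (x * g) := rfl

lemma avg_apply (A : Finset G) (μ : G → ℝ) (f : L2 G) (x : G) :
    avg (reg G) A μ f x = ∑ g ∈ A, μ g * f (x * g) := by
  rw [avg, lp.coeFn_sum]; simp

/-! convolution powers -/
variable {μ : G → ℝ} {A : Finset G}

/-- standing assumptions -/
structure SP (μ : G → ℝ) (A : Finset G) : Prop where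
  nn : ∀ g, 0 ≤ μ g
  one : ∑ g ∈ A, μ g = 1
  mem : ∀ g, g ∈ A ↔ μ g ≠ 0
  symm : ∀ g, μ g = μ g⁻¹

lemma SP.inv (h : SP μ A) : ∀ g ∈ A, g⁻¹ ∈ A := by
  intro g hg; rw [h.mem] at hg ⊢; rwa [← h.symm]

lemma SP.pos (h : SP μ A) : ∀ g ∈ A, 0 < μ g := fun g hg =>
  lt_of_le_of_ne (h.nn g) ((h.mem g).1 hg).symm

lemma SP.succ (h : SP μ A) (n : ℕ) (x : G) :
    convPow μ (n + 1) x = ∑ g ∈ A, μ g * convPow μ n (g⁻¹ * x) := by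
  show ∑' g, _ = _
  refine tsum_eq_sum fun g hg => ?_
  rw [h.mem] at hg; push Not at hg; simp [hg]

lemma SP.sum_inv (h : SP μ A) (F : G → ℝ) : ∑ g ∈ A, μ g * F g⁻¹ = ∑ g ∈ A, μ g * F g := by
  refine Finset.sum_bij' (fun g _ => g⁻¹) (fun g _ => g⁻¹) h.inv h.inv (by simp) (by simp) ?_
  intro g hg
  rw [← h.symm]

lemma SP.succ' (h : SP μ A) (n : ℕ) : ∀ x : G,
    convPow μ (n + 1) x = ∑ g ∈ A, μ g * convPow μ n (x * g) := by
  induction n with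
  | zero =>
    intro x
    rw [h.succ, ← h.sum_inv]
    refine Finset.sum_congr rfl fun g _ => ?_
    congr 1
    simp only [convPow, inv_inv]
    congr 1
    rw [eq_iff_iff, mul_eq_one_iff_eq_inv, mul_eq_one_iff_eq_inv, eq_inv_iff_mul_eq_one, ← mul_eq_one_iff_eq_inv]
    constructor
    · intro hh; rw [mul_eq_one_iff_eq_inv] at hh ⊢; rw [hh]; simp
    · intro hh; rw [mul_eq_one_iff_eq_inv] at hh ⊢; rw [hh]; simp
  | succ n ih =>
    intro x
    rw [h.succ]
    conv_lhs => enter [2, g]; rw [ih, Finset.mul_sum]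
    conv_rhs => enter [2, g]; rw [h.succ, Finset.mul_sum]
    rw [Finset.sum_comm]
    refine Finset.sum_congr rfl fun g _ => Finset.sum_congr rfl fun k _ => ?_
    rw [mul_assoc]; ring

lemma SP.psymm (h : SP μ A) (n : ℕ) : ∀ x : G, convPow μ n x⁻¹ = convPow μ n x := by
  induction n with
  | zero => intro x; simp [convPow]
  | succ n ih =>
    intro x
    rw [h.succ, h.succ']
    refine Finset.sum_congr rfl fun g _ => ?_
    rw [← ih]; simp

lemma SP.pnn (h : SP μ A) (n : ℕ) : ∀ x : G, 0 ≤ convPow μ n x := by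
  induction n with
  | zero => intro x; simp only [convPow]; split_ifs <;> norm_num
  | succ n ih =>
    intro x
    rw [h.succ]
    exact Finset.sum_nonneg fun g _ => mul_nonneg (h.nn g) (ih _)

open scoped Pointwise in
lemma SP.supp (h : SP μ A) (n : ℕ) : ∀ x : G, convPow μ n x ≠ 0 → x ∈ A ^ n := by
  induction n with
  | zero => intro x; simp [convPow]
  | succ n ih =>
    intro x hx
    rw [h.succ] at hx
    obtain ⟨g, hg, hgx⟩ := Finset.exists_ne_zero_of_sum_ne_zero hx
    have := ih _ (right_ne_zero_of_mul hgx)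
    rw [pow_succ']
    exact Finset.mem_mul.2 ⟨g, hg, _, this, by simp⟩

open scoped Pointwise in
lemma SP.fin (h : SP μ A) (n : ℕ) : (Function.support (convPow μ n)).Finite :=
  ((A ^ n).finite_toSet).subset fun x hx => h.supp n x hx

/-- the distribution at time n as a vector -/
def SP.vec (h : SP μ A) (n : ℕ) : L2 G := toL2 (convPow μ n) (h.fin n)

@[simp] lemma SP.vec_apply (h : SP μ A) (n : ℕ) (x : G) : h.vec n x = convPow μ n x := rfl

lemma SP.vec_succ (h : SP μ A) (n : ℕ) : h.vec (n + 1) = avg (reg G) A μ (h.vec n) := by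
  ext x
  rw [avg_apply, h.vec_apply, h.succ']; rfl

lemma SP.vec_add (h : SP μ A) (n j : ℕ) : h.vec (j + n) = (avg (reg G) A μ)^[n] (h.vec j) := by
  induction n with
  | zero => rfl
  | succ n ih => rw [← add_assoc, h.vec_succ, ih, Function.iterate_succ_apply']

lemma SP.inner_vec (h : SP μ A) (m k : ℕ) : ∀ x : G,
    ⟪h.vec m, reg G x (h.vec k)⟫ = convPow μ (m + k) x := by
  induction m with
  | zero =>
    intro x
    rw [l2_inner, tsum_eq_single 1]
    · simp [convPow]
    · intro y hy; simp [convPow, hy]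
  | succ m ih =>
    intro x
    rw [h.vec_succ, avg_inner_left, show m + 1 + k = (m + k) + 1 by ring, h.succ]
    refine Finset.sum_congr rfl fun g _ => ?_
    rw [rep_inner, ← rep_mul, ih]

lemma SP.summable (h : SP μ A) (m : ℕ) (F : G → ℝ) : Summable fun x => convPow μ m x * F x :=
  summable_of_hasFiniteSupport ((h.fin m).subset fun x hx => left_ne_zero_of_mul hx)

/-- expectation -/
lemma SP.exp_succ (h : SP μ A) (m : ℕ) (F : G → ℝ) : ∑' x, convPow μ (m + 1) x * F x =
    ∑ g ∈ A, μ g * ∑' x, convPow μ m x * F (g * x) := by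
  have e : ∀ g : G, ∑' x, convPow μ m (g⁻¹ * x) * F x = ∑' x, convPow μ m x * F (g * x) := by
    intro g
    rw [← (Equiv.mulLeft g).tsum_eq]; simp
  have s : ∀ g : G, Summable fun x => convPow μ m (g⁻¹ * x) * F x := by
    intro g
    rw [← (Equiv.mulLeft g).summable_iff]
    refine (h.summable m fun x => F (g * x)).congr fun x => ?_
    simp
  simp_rw [← e, ← tsum_mul_left]
  rw [← Summable.tsum_finsetSum fun g _ => (s g).mul_left _]
  refine tsum_congr fun x => ?_
  rw [h.succ, Finset.sum_mul]
  exact Finset.sum_congr rfl fun g _ => by ring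

lemma SP.mass (h : SP μ A) (m : ℕ) : ∑' x, convPow μ m x = 1 := by
  induction m with
  | zero => simp [convPow]
  | succ m ih =>
    have := h.exp_succ m (fun _ => 1)
    simp only [mul_one, ih] at this
    rw [this, h.one]

lemma SP.inner_iter (h : SP μ A) (m : ℕ) (f : L2 G) : ∀ ψ : L2 G,
    ⟪(avg (reg G) A μ)^[m] f, ψ⟫ = ∑' g, convPow μ m g * ⟪reg G g f, ψ⟫ := by
  induction m with
  | zero =>
    intro ψ
    rw [tsum_eq_single 1]
    · simp [convPow]
    · intro y hy; simp [convPow, hy]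
  | succ m ih =>
    intro ψ
    rw [Function.iterate_succ_apply', avg_inner_left, h.exp_succ]
    refine Finset.sum_congr rfl fun g _ => ?_
    rw [rep_inner, ih]
    congr 1
    refine tsum_congr fun x => ?_
    rw [rep_mul, rep_inner _ g]

/-- all group elements are controlled by the energy -/
lemma SP.good (h : SP μ A) (hnd : Subsemigroup.closure (A : Set G) = ⊤)
    (haper : ∀ d : ℕ, (∀ n : ℕ, 1 ≤ n → 0 < convPow μ n 1 → d ∣ n) → d = 1) (g : G) :
    Good (reg G) A μ g := by
  have key : ∀ n : ℕ, ∀ x, convPow μ n x ≠ 0 → (Even n → Good (reg G) A μ x) ∧ 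
      (Odd n → ∀ a ∈ A, Good (reg G) A μ (a * x)) := by
    intro n
    induction n with
    | zero => 
      intro x hx
      have : x = 1 := by by_contra hne; simp [convPow, hne] at hx
      subst this
      exact ⟨fun _ => Good.one, fun hh => by simp at hh⟩
    | succ n ih =>
      intro x hx
      rw [h.succ] at hx
      obtain ⟨g, hg, hgx⟩ := Finset.exists_ne_zero_of_sum_ne_zero hx
      obtain ⟨i1, i2⟩ := ih _ (right_ne_zero_of_mul hgx)
      refine ⟨fun he => ?_, fun ho a ha => ?_⟩
      · have := i2 (by rw [Nat.even_add_one] at he; simpa using he) g hg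
        simpa using this
      · have := i1 (by rw [Nat.odd_add_one] at ho; simpa using ho)
        have := (Good.pair (τ := reg G) h.inv h.nn h.one h.pos ha hg).mul this
        simpa [mul_assoc] using this
  obtain ⟨n, hn, ho⟩ : ∃ n, convPow μ n 1 ≠ 0 ∧ Odd n := by
    by_contra hcon
    push Not at hcon
    have := haper 2 fun n _ hn => by
      have := hcon n hn.ne'
      rw [Nat.not_odd_iff_even] at this
      exact this.two_dvd
    omega
  have hA : ∀ a ∈ A, Good (reg G) A μ a := fun a ha => by
    simpa using (key n 1 hn).2 ho a ha
  have hg : g ∈ Subsemigroup.closure (A : Set G) := by rw [hnd]; trivial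
  induction hg using Subsemigroup.closure_induction with
  | mem x hx => exact hA x hx
  | mul x y _ _ hx hy => exact hx.mul hy
end conc
end part6

section part7
section quant
open scoped RealInnerProductSpace Pointwise

variable {G : Type*} [Group G] {μ : G → ℝ} {A : Finset G}

lemma SP.norm_anti (h : SP μ A) {j m : ℕ} (hjm : j ≤ m) : ‖h.vec m‖ ≤ ‖h.vec j‖ := by
  obtain ⟨k, rfl⟩ := Nat.exists_eq_add_of_le hjm
  have e := norm_iter_sub (τ := reg G) (A := A) (μ := μ) (h.vec j) k
  rw [← h.vec_add] at e
  have : 0 ≤ ∑ i ∈ Finset.range k, energy (reg G) A μ ((avg (reg G) A μ)^[i] (h.vec j)) :=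
    Finset.sum_nonneg fun i _ => energy_nonneg h.nn h.one _
  exact (sq_le_sq₀ (norm_nonneg _) (norm_nonneg _)).1 (by linarith)

lemma SP.grad (h : SP μ A) {U : Finset G} {C : ℝ} (hC : 0 ≤ C)
    (hUC : ∀ g ∈ U, ∀ f : L2 G, ‖reg G g f - f‖ ≤ C * Real.sqrt (energy (reg G) A μ f))
    {j m r : ℕ} (hjm : j ≤ m) {g : G} (hg : g ∈ U ^ r) (x : G) :
    |convPow μ (m + 2 * j) (x * g) - convPow μ (m + 2 * j) x| ≤
      r * C * ‖h.vec j‖ ^ 2 / Real.sqrt (j + 1) := by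
  rw [← h.inner_vec, ← h.inner_vec, rep_mul, ← inner_sub_right, ← map_sub]
  have hs : 0 < Real.sqrt ((j : ℝ) + 1) := Real.sqrt_pos.2 (by positivity)
  have h1 := good_pow hUC r g hg (h.vec (2 * j))
  have h2 : Real.sqrt (energy (reg G) A μ (h.vec (2 * j))) ≤ ‖h.vec j‖ / Real.sqrt (j + 1) := by
    have := energy_iter_le (τ := reg G) h.inv h.symm (h.vec j) j
    rw [← h.vec_add, ← two_mul] at this
    rw [le_div_iff₀ hs, ← Real.sqrt_mul (energy_nonneg h.nn h.one _)]
    refine Real.sqrt_le_iff.2 ⟨norm_nonneg _, by linarith⟩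
  refine (abs_real_inner_le_norm _ _).trans ?_
  rw [LinearIsometryEquiv.norm_map]
  calc _ ≤ ‖h.vec j‖ * (r * (C * (‖h.vec j‖ / Real.sqrt (j + 1)))) := by
        refine mul_le_mul (h.norm_anti hjm) (h1.trans ?_) (norm_nonneg _) (norm_nonneg _)
        gcongr
    _ = _ := by field_simp

lemma SP.psummable (h : SP μ A) (n : ℕ) : Summable (convPow μ n) := by
  simpa using h.summable n (fun _ => 1)

lemma SP.ondiag (h : SP μ A) {U : Finset G} {C : ℝ} (hC : 0 ≤ C)
    (hUC : ∀ g ∈ U, ∀ f : L2 G, ‖reg G g f - f‖ ≤ C * Real.sqrt (energy (reg G) A μ f))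
    (n R : ℕ) :
    (U ^ R).card * ‖h.vec n‖ ^ 2 ≤ 1 + (U ^ R).card *
      (R * C * ‖h.vec (n / 2)‖ ^ 2 / Real.sqrt ((n / 2 : ℕ) + 1)) := by
  have e : ‖h.vec n‖ ^ 2 = convPow μ (2 * n) 1 := by
    have := h.inner_vec n n 1
    rw [map_one, two_mul] at *
    rw [← this, ← real_inner_self_eq_norm_sq]; rfl
  have e2 : 2 * n = (2 * n - 2 * (n / 2)) + 2 * (n / 2) := by omega
  have hb : ∀ g ∈ U ^ R, ‖h.vec n‖ ^ 2 ≤ convPow μ (2 * n) g +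
      R * C * ‖h.vec (n / 2)‖ ^ 2 / Real.sqrt ((n / 2 : ℕ) + 1) := by
    intro g hg
    have := h.grad hC hUC (j := n / 2) (m := 2 * n - 2 * (n / 2)) (by omega) hg 1
    rw [← e2, one_mul, ← e] at this
    have := neg_le_of_abs_le this
    linarith
  have := Finset.sum_le_sum hb
  rw [Finset.sum_const, Finset.sum_add_distrib, Finset.sum_const, nsmul_eq_mul, nsmul_eq_mul] at this
  refine this.trans ?_
  gcongr
  rw [← h.mass (2 * n)]
  exact (h.psummable _).sum_le_tsum _ fun x _ => h.pnn _ _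

lemma SP.diag (h : SP μ A) {U : Finset G} {C : ℝ} (hC : 0 ≤ C) (h1U : (1 : G) ∈ U)
    (hUC : ∀ g ∈ U, ∀ f : L2 G, ‖reg G g f - f‖ ≤ C * Real.sqrt (energy (reg G) A μ f))
    (hdoub : ∀ K : ℕ, ∃ C : ℕ, ∀ R : ℕ, (U ^ (K * (R + 1))).card ≤ C * (U ^ R).card) :
    ∃ A₀ : ℝ, 0 ≤ A₀ ∧ ∀ n : ℕ, ‖h.vec n‖ ^ 2 * (U ^ (Nat.sqrt n)).card ≤ A₀ := by
  obtain ⟨D, hD⟩ := hdoub 2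
  obtain ⟨L, hL⟩ := exists_nat_ge (4 * C * D + 1)
  have hL0 : (0 : ℝ) < L := by have : 0 ≤ 4 * C * D := by positivity
                               linarith
  have hL0' : 0 < L := by exact_mod_cast hL0
  obtain ⟨B, hB⟩ := hdoub L
  have mono : ∀ {a b : ℕ}, a ≤ b → (U ^ a).card ≤ (U ^ b).card := fun hab =>
    Finset.card_le_card (Finset.pow_subset_pow_right h1U hab)
  refine ⟨2 * B + 1, by positivity, fun n => ?_⟩
  induction n using Nat.strong_induction_on with
  | _ n ih =>
  rcases Nat.eq_zero_or_pos n with rfl | hn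
  · have : ‖h.vec 0‖ ^ 2 = 1 := by
      have := h.inner_vec 0 0 1
      rw [map_one] at this
      rw [← real_inner_self_eq_norm_sq]
      refine Eq.trans this ?_
      simp [convPow]
    rw [this]; simp
  set j := n / 2 with hj
  have hjn : j < n := by omega
  have ihj := ih j hjn
  set s := Nat.sqrt n
  have hs1 : s * s ≤ n := Nat.sqrt_le n
  have hj1 : j < (Nat.sqrt j + 1) * (Nat.sqrt j + 1) := Nat.lt_succ_sqrt j
  set t := Nat.sqrt j
  have hst : s ≤ 2 * (t + 1) := by
    have : n ≤ 2 * j + 1 := by omega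
    by_contra hcon
    push Not at hcon
    nlinarith
  set R := s / L
  have hRL : R * L ≤ s := Nat.div_mul_le_self s L
  have hRs : s ≤ L * (R + 1) := (Nat.lt_mul_div_succ s hL0').le
  have v1 : ((U ^ s).card : ℝ) ≤ D * (U ^ t).card := by
    exact_mod_cast (mono hst).trans (hD t)
  have v2 : ((U ^ s).card : ℝ) ≤ B * (U ^ R).card := by
    exact_mod_cast (mono hRs).trans (hB R)
  have v3 : (0 : ℝ) < (U ^ R).card := by
    have : (U ^ R).Nonempty := ⟨1, Finset.one_mem_pow h1U⟩
    exact_mod_cast this.card_pos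
  have od := h.ondiag hC hUC n R
  rw [← hj] at od
  set q := Real.sqrt ((j : ℝ) + 1)
  have hq : 0 < q := Real.sqrt_pos.2 (by positivity)
  have hq2 : q ^ 2 = j + 1 := Real.sq_sqrt (by positivity)
  have hsq : (s : ℝ) ≤ 2 * q := by
    have : (s : ℝ) * s ≤ 4 * (j + 1) := by
      have : s * s ≤ 4 * (j + 1) := by omega
      exact_mod_cast this
    nlinarith
  have hRq : (R : ℝ) / q ≤ 2 / L := by
    rw [div_le_div_iff₀ hq hL0]
    exact le_trans (by exact_mod_cast hRL) hsq
  generalize ((U ^ s).card : ℝ) = Vs at *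
  have huj : 0 ≤ ‖h.vec j‖ ^ 2 := by positivity
  generalize ‖h.vec j‖ ^ 2 = uj at *
  have hVs : 0 ≤ D * ((U ^ t).card : ℝ) := by positivity
  have od2 : ‖h.vec n‖ ^ 2 ≤ 1 / (U ^ R).card + (R / q) * (C * uj) := by
    rw [← sub_le_iff_le_add, le_div_iff₀ v3]
    have : (R / q) * (C * uj) = R * C * uj / q := by ring
    rw [this]; linarith
  have hLC : 2 / L * C * D ≤ 1 / 2 := by
    rw [div_mul_eq_mul_div, div_mul_eq_mul_div, div_le_iff₀ hL0]; linarith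
  by_cases hVs0 : Vs < 0
  · have : ‖h.vec n‖ ^ 2 * Vs ≤ 0 := mul_nonpos_of_nonneg_of_nonpos (by positivity) hVs0.le
    have : (0:ℝ) ≤ 2 * B + 1 := by positivity
    linarith
  push Not at hVs0
  calc ‖h.vec n‖ ^ 2 * Vs ≤ (1 / (U ^ R).card + (R / q) * (C * uj)) * Vs := by gcongr
    _ = Vs / (U ^ R).card + (R / q) * (C * uj) * Vs := by ring
    _ ≤ B + (2 / L) * (C * uj) * (D * (U ^ t).card) := by
        gcongr
        rwa [div_le_iff₀ v3]
    _ = B + (2 / L * C * D) * (uj * (U ^ t).card) := by ring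
    _ ≤ B + 1 / 2 * (2 * B + 1) := by gcongr
    _ ≤ _ := by linarith
end quant
end part7

section part8
section tight
open scoped RealInnerProductSpace Pointwise

variable {G : Type*} [Group G] {μ : G → ℝ} {A : Finset G}

/-- tail of the distribution -/
def tail (μ : G → ℝ) (U : Finset G) (n R : ℕ) : ℝ :=
  ∑' x, convPow μ n x * (if x ∈ U ^ R then 0 else 1)

lemma SP.tail_succ (h : SP μ A) {U : Finset G} (hAU : A ⊆ U) (hU : ∀ x ∈ U, x⁻¹ ∈ U) (n R : ℕ) :
    tail μ U (n + 1) (R + 1) ≤ tail μ U n R := by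
  unfold tail
  rw [h.exp_succ]
  calc _ ≤ ∑ g ∈ A, μ g * ∑' x, convPow μ n x * (if x ∈ U ^ R then 0 else 1) := by
        refine Finset.sum_le_sum fun g hg => mul_le_mul_of_nonneg_left ?_ (h.nn g)
        refine Summable.tsum_le_tsum (fun x => ?_) (h.summable n _) (h.summable n _)
        refine mul_le_mul_of_nonneg_left ?_ (h.pnn n x)
        by_cases hx : x ∈ U ^ R
        · have : g * x ∈ U ^ (R + 1) := by
            rw [pow_succ']; exact Finset.mul_mem_mul (hAU hg) hx
          simp [hx, this]
        · simp only [hx, if_false]; split_ifs <;> norm_num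
    _ = _ := by rw [← Finset.sum_mul, h.one, one_mul]

lemma SP.tail_mono (h : SP μ A) {U : Finset G} (h1U : 1 ∈ U) (n : ℕ) {R R' : ℕ} (hR : R ≤ R') :
    tail μ U n R' ≤ tail μ U n R := by
  refine Summable.tsum_le_tsum (fun x => ?_) (h.summable n _) (h.summable n _)
  refine mul_le_mul_of_nonneg_left ?_ (h.pnn n x)
  by_cases hx : x ∈ U ^ R
  · have := Finset.pow_subset_pow_right h1U hR hx
    simp [hx, this]
  · simp only [hx, if_false]; split_ifs <;> norm_num

lemma SP.tail_even (h : SP μ A) {U : Finset G} (hAU : A ⊆ U) (hU : ∀ x ∈ U, x⁻¹ ∈ U)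
    (h1U : (1 : G) ∈ U) (hgen : Subgroup.closure (U : Set G) = ⊤) (k R : ℕ) :
    (R : ℝ) ^ 2 * (U ^ R).card * tail μ U (2 * k) (3 * R) ≤ 4 * k * (U ^ (2 * R + 1)).card := by
  obtain ⟨len, hlen⟩ : ∃ len : G → ℕ, ∀ x k, len x ≤ k ↔ x ∈ U ^ k := by
    refine ⟨fun x => Nat.find (exists_ball hU h1U hgen x), fun x k => ⟨fun hk => ?_, fun hk => ?_⟩⟩
    · exact Finset.pow_subset_pow_right h1U hk (Nat.find_spec (exists_ball hU h1U hgen x))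
    · exact Nat.find_min' _ hk
  have lmul : ∀ x y, len (x * y) ≤ len x + len y := by
    intro x y
    rw [hlen, pow_add]
    exact Finset.mul_mem_mul ((hlen _ _).1 le_rfl) ((hlen _ _).1 le_rfl)
  have linv : ∀ x, len x⁻¹ ≤ len x := by
    intro x
    rw [hlen]; exact ball_inv hU ((hlen _ _).1 le_rfl)
  have lU : ∀ x ∈ U, len x ≤ 1 := by intro x hx; rw [hlen]; simpa using hx
  have hf : (Function.support fun x => ((2 * R - len x : ℕ) : ℝ)).Finite := by
    refine ((U ^ (2 * R)).finite_toSet).subset fun x hx => ?_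
    simp only [Function.mem_support, ne_eq, Nat.cast_eq_zero] at hx
    rw [Finset.mem_coe, ← hlen]; omega
  set φ : L2 G := toL2 _ hf with hφ
  have φa : ∀ x, φ x = ((2 * R - len x : ℕ) : ℝ) := fun x => rfl
  -- upper bound
  have up1 : ∀ g ∈ U, ‖reg G g φ - φ‖ ^ 2 ≤ (U ^ (2 * R + 1)).card := by
    intro g hg
    rw [l2_norm_sq, tsum_eq_sum (s := U ^ (2 * R + 1))]
    · refine (Finset.sum_le_card_nsmul _ _ 1 fun x _ => ?_).trans (by simp)
      simp only [lp.coeFn_sub, Pi.sub_apply, reg_apply, φa]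
      have a1 := lmul x g
      have a2 := lmul (x * g) g⁻¹
      have a3 := linv g
      have a4 := lU g hg
      rw [mul_inv_cancel_right] at a2
      rw [sq_le_one_iff_abs_le_one, abs_le]
      have b1 : 2 * R - len (x * g) ≤ (2 * R - len x) + 1 := by omega
      have b2 : 2 * R - len x ≤ (2 * R - len (x * g)) + 1 := by omega
      have c1 : ((2 * R - len (x * g) : ℕ) : ℝ) ≤ ((2 * R - len x : ℕ) : ℝ) + 1 := by exact_mod_cast b1
      have c2 : ((2 * R - len x : ℕ) : ℝ) ≤ ((2 * R - len (x * g) : ℕ) : ℝ) + 1 := by exact_mod_cast b2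
      constructor <;> linarith
    · intro x hx
      rw [← hlen] at hx
      have a2 := lmul (x * g) g⁻¹
      have a3 := linv g
      have a4 := lU g hg
      rw [mul_inv_cancel_right] at a2
      simp only [lp.coeFn_sub, Pi.sub_apply, reg_apply, φa]
      rw [show 2 * R - len (x * g) = 0 by omega, show 2 * R - len x = 0 by omega]; simp
  have up2 : energy (reg G) A μ φ ≤ 2 * (U ^ (2 * R + 1)).card := by
    rw [energy_eq h.one]
    have : ∑ g ∈ A, ∑ k ∈ A, μ g * μ k * ‖reg G g φ - reg G k φ‖ ^ 2 ≤ 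
        ∑ g ∈ A, ∑ k ∈ A, μ g * μ k * (4 * (U ^ (2 * R + 1)).card) := by
      refine Finset.sum_le_sum fun g hg => Finset.sum_le_sum fun k hk => ?_
      refine mul_le_mul_of_nonneg_left ?_ (mul_nonneg (h.nn _) (h.nn _))
      have t1 := up1 g (hAU hg)
      have t2 := up1 k (hAU hk)
      have t3 : ‖reg G g φ - reg G k φ‖ ≤ ‖reg G g φ - φ‖ + ‖reg G k φ - φ‖ := by
        have : reg G g φ - reg G k φ = (reg G g φ - φ) - (reg G k φ - φ) := by abel
        rw [this]; exact norm_sub_le _ _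
      have t4 : ‖reg G g φ - reg G k φ‖ ^ 2 ≤ (‖reg G g φ - φ‖ + ‖reg G k φ - φ‖) ^ 2 := by gcongr
      nlinarith [sq_nonneg (‖reg G g φ - φ‖ - ‖reg G k φ - φ‖)]
    simp_rw [← Finset.sum_mul, ← Finset.mul_sum, h.one, mul_one, h.one] at this
    linarith
  -- lower bound
  have low : ∀ g, g ∉ U ^ (3 * R) → (R : ℝ) ^ 2 * (U ^ R).card ≤ ‖reg G g φ - φ‖ ^ 2 := by
    intro g hg
    rw [← hlen] at hg
    rw [l2_norm_sq]
    refine le_trans ?_ ((l2_summable _).sum_le_tsum (U ^ R) fun x _ => sq_nonneg _)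
    refine le_trans (le_of_eq ?_) (Finset.card_nsmul_le_sum _ _ ((R : ℝ) ^ 2) fun x hx => ?_)
    · simp [mul_comm]
    · rw [← hlen] at hx
      have a1 := lmul x⁻¹ (x * g)
      have a2 := linv x
      rw [inv_mul_cancel_left] at a1
      simp only [lp.coeFn_sub, Pi.sub_apply, reg_apply, φa]
      rw [show 2 * R - len (x * g) = 0 by omega]
      have : R ≤ 2 * R - len x := by omega
      have : (R : ℝ) ≤ ((2 * R - len x : ℕ) : ℝ) := by exact_mod_cast this
      have h0 : (0 : ℝ) ≤ R := by positivity
      push_cast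
      nlinarith
  have id1 : ‖(avg (reg G) A μ)^[k] φ‖ ^ 2 = ∑' g, convPow μ (2 * k) g * ⟪reg G g φ, φ⟫ := by
    rw [← h.inner_iter, ← real_inner_self_eq_norm_sq, two_mul, Function.iterate_add_apply]
    have : ∀ (m : ℕ) (f ψ : L2 G), ⟪(avg (reg G) A μ)^[m] f, ψ⟫ = ⟪f, (avg (reg G) A μ)^[m] ψ⟫ := by
      intro m
      induction m with
      | zero => intro f ψ; rfl
      | succ m ih =>
        intro f ψ
        rw [Function.iterate_succ_apply', avg_symm h.inv h.symm, ih, ← Function.iterate_succ_apply]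
    rw [this k ((avg (reg G) A μ)^[k] φ)]
  have id2 : ‖φ‖ ^ 2 = ∑' g, convPow μ (2 * k) g * ‖φ‖ ^ 2 := by
    rw [tsum_mul_right, h.mass, one_mul]
  have id3 : ‖φ‖ ^ 2 - ‖(avg (reg G) A μ)^[k] φ‖ ^ 2 = 
      ∑' g, convPow μ (2 * k) g * (‖reg G g φ - φ‖ ^ 2 / 2) := by
    rw [id1]
    conv_lhs => enter [1]; rw [id2]
    rw [← Summable.tsum_sub (h.summable _ _) (h.summable _ _)]
    refine tsum_congr fun g => ?_
    rw [norm_sub_sq_real, LinearIsometryEquiv.norm_map]; ring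
  have low2 : (R : ℝ) ^ 2 * (U ^ R).card / 2 * tail μ U (2 * k) (3 * R) ≤ 
      ‖φ‖ ^ 2 - ‖(avg (reg G) A μ)^[k] φ‖ ^ 2 := by
    rw [id3, tail, ← tsum_mul_left]
    refine Summable.tsum_le_tsum (fun x => ?_) ((h.summable _ _).mul_left _) (h.summable _ _)
    rw [mul_left_comm]
    refine mul_le_mul_of_nonneg_left ?_ (h.pnn _ x)
    split_ifs with hx
    · rw [mul_zero]; positivity
    · have := low x hx
      linarith
  have fin := norm_iter_sub_le (τ := reg G) h.inv h.symm φ k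
  have : (k : ℝ) * energy (reg G) A μ φ ≤ k * (2 * (U ^ (2 * R + 1)).card) := by gcongr
  linarith

lemma SP.tail_bound (h : SP μ A) {U : Finset G} (hAU : A ⊆ U) (hU : ∀ x ∈ U, x⁻¹ ∈ U)
    (h1U : (1 : G) ∈ U) (hgen : Subgroup.closure (U : Set G) = ⊤) 
    (hdoub : ∀ K : ℕ, ∃ C : ℕ, ∀ R : ℕ, (U ^ (K * (R + 1))).card ≤ C * (U ^ R).card) :
    ∀ ε > (0 : ℝ), ∃ K : ℕ, ∀ n ≥ 1, tail μ U n (K * (Nat.sqrt n + 1)) ≤ ε := by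
  obtain ⟨D, hD⟩ := hdoub 2
  intro ε hε
  obtain ⟨K, hK⟩ := exists_nat_ge (2 * D / ε + 1)
  have hD0 : 0 ≤ 2 * D / ε := by positivity
  have hK1 : (1 : ℝ) ≤ K := by linarith
  have hK1' : 1 ≤ K := by exact_mod_cast hK1
  refine ⟨4 * K, fun n hn => ?_⟩
  set R := K * (Nat.sqrt n + 1) with hR
  have hR1 : 1 ≤ R := by nlinarith
  have s1 : tail μ U n (4 * K * (Nat.sqrt n + 1)) ≤ tail μ U (2 * (n / 2)) (3 * R) := by
    rcases Nat.even_or_odd' n with ⟨c, hc | hc⟩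
    · have : 2 * (n / 2) = n := by omega
      rw [this]
      exact h.tail_mono h1U n (by rw [mul_assoc]; omega)
    · have : n = 2 * (n / 2) + 1 := by omega
      refine (h.tail_mono h1U n (R := 3 * R + 1) (by rw [mul_assoc]; omega)).trans ?_
      conv_lhs => rw [this]
      exact h.tail_succ hAU hU _ _
  refine s1.trans ?_
  have s2 := h.tail_even hAU hU h1U hgen (n / 2) R
  have v : (0 : ℝ) < (U ^ R).card := by
    have : (U ^ R).Nonempty := ⟨1, Finset.one_mem_pow h1U⟩
    exact_mod_cast this.card_pos
  have v2 : ((U ^ (2 * R + 1)).card : ℝ) ≤ D * (U ^ R).card := by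
    exact_mod_cast (Finset.card_le_card (Finset.pow_subset_pow_right h1U (by omega))).trans (hD R)
  generalize tail μ U (2 * (n / 2)) (3 * R) = T at *
  have n1 : 4 * ((n / 2 : ℕ) : ℝ) ≤ 2 * n := by
    have : 4 * (n / 2) ≤ 2 * n := by omega
    exact_mod_cast this
  have s3 : (R : ℝ) ^ 2 * T ≤ 2 * n * D := by
    refine le_of_mul_le_mul_right ?_ v
    calc _ = (R : ℝ) ^ 2 * (U ^ R).card * T := by ring
      _ ≤ _ := s2
      _ ≤ 2 * n * (D * (U ^ R).card) := by gcongr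
      _ = _ := by ring
  have r1 : (K : ℝ) * n ≤ (R : ℝ) ^ 2 := by
    have a := Nat.lt_succ_sqrt n
    have : K * n ≤ R ^ 2 := by
      rw [hR, mul_pow, sq (Nat.sqrt n + 1), sq]
      exact Nat.mul_le_mul (by nlinarith) a.le
    exact_mod_cast this
  have hn0 : (0 : ℝ) < n := by exact_mod_cast hn
  by_contra hcon
  push Not at hcon
  have : (K : ℝ) * n * ε < 2 * n * D := by
    calc _ ≤ (R : ℝ) ^ 2 * ε := by gcongr
      _ < R ^ 2 * T := by gcongr
      _ ≤ _ := s3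
  have k2 : 2 * D < K * ε := by
    have : 2 * D / ε < K := by linarith
    rwa [div_lt_iff₀ hε] at this
  nlinarith
end tight
end part8

section part9
section final
open scoped Pointwise

lemma wl_mem {G : Type*} [Group G] {S U : Finset G} (hSgen : Subgroup.closure (S : Set G) = ⊤)
    (hSU : S ⊆ U) (hU : ∀ x ∈ U, x⁻¹ ∈ U) (g : G) : g ∈ U ^ (wordLength (S : Set G) g) := by
  have hne : {k | ∃ l : List G, l.length = k ∧ (∀ x ∈ l, x ∈ (S : Set G) ∨ x⁻¹ ∈ (S : Set G)) ∧
      l.prod = g}.Nonempty := by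
    have hg : g ∈ (Subgroup.closure (S : Set G)).toSubmonoid := by rw [hSgen]; trivial
    rw [Subgroup.closure_toSubmonoid] at hg
    obtain ⟨l, h1, h2⟩ := Submonoid.exists_list_of_mem_closure hg
    exact ⟨l.length, l, rfl, fun x hx => by simpa using h1 x hx, h2⟩
  obtain ⟨l, h1, h2, h3⟩ := Nat.sInf_mem hne
  have : ∀ l : List G, (∀ x ∈ l, x ∈ (S : Set G) ∨ x⁻¹ ∈ (S : Set G)) → l.prod ∈ U ^ l.length := by
    intro l
    induction l with
    | nil => intro _; simp
    | cons a l ih =>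
      intro hl
      rw [List.prod_cons, List.length_cons, pow_succ']
      refine Finset.mul_mem_mul ?_ (ih fun x hx => hl x (List.mem_cons_of_mem _ hx))
      rcases hl a List.mem_cons_self with ha | ha
      · exact hSU ha
      · simpa using hU _ (hSU ha)
  have := this l h2
  rw [h3, h1] at this
  exact this

theorem core {G : Type*} [Group G]
    (hvn : ∃ H : Subgroup G, H.FiniteIndex ∧ Group.IsNilpotent H)
    (S : Finset G) (hSgen : Subgroup.closure (S : Set G) = ⊤)
    (μ : G → ℝ) (hμ0 : ∀ g, 0 ≤ μ g) (hμ1 : HasSum μ 1)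
    (hfin : (Function.support μ).Finite)
    (hsym : ∀ g : G, μ g = μ g⁻¹)
    (hnd : Subsemigroup.closure (Function.support μ) = ⊤)
    (haper : ∀ d : ℕ, (∀ n : ℕ, 1 ≤ n → 0 < convPow μ n 1 → d ∣ n) → d = 1)
    (r : ℕ → ℝ) (hr : Tendsto (fun n => r n / Real.sqrt n) atTop (nhds 0))
    (ε : ℝ) (hε : 0 < ε) : ∃ N : ℕ, ∀ n ≥ N, ∃ V : Set G,
      1 - ε ≤ measOf (convPow μ n) V ∧
      ∀ h ∈ V, ∀ g : G, (wordLength (S : Set G) g : ℝ) ≤ r n →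
        (1 - ε) * convPow μ n h ≤ convPow μ n (h * g) ∧
          convPow μ n (h * g) ≤ (1 + ε) * convPow μ n h := by
  set A : Finset G := hfin.toFinset with hA
  have sp : SP μ A := by
    refine ⟨hμ0, ?_, fun g => by simp [hA], hsym⟩
    rw [← hμ1.tsum_eq, tsum_eq_sum (s := A)]
    intro g hg; simpa [hA] using hg
  set U : Finset G := S ∪ S⁻¹ ∪ A ∪ {1} with hUdef
  have hSU : S ⊆ U := by intro x hx; simp [hUdef, hx]
  have hAU : A ⊆ U := by intro x hx; simp [hUdef, hx]
  have h1U : (1 : G) ∈ U := by simp [hUdef]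
  have hU : ∀ x ∈ U, x⁻¹ ∈ U := by
    intro x hx
    simp only [hUdef, Finset.mem_union, Finset.mem_inv', Finset.mem_singleton, inv_inv] at hx ⊢
    rcases hx with ((hx | hx) | hx) | hx
    · tauto
    · tauto
    · have := sp.inv x hx; tauto
    · right; simp [hx]
  have hgen : Subgroup.closure (U : Set G) = ⊤ := by
    rw [eq_top_iff, ← hSgen]
    exact Subgroup.closure_mono (by exact_mod_cast hSU)
  have hdoub := doubling hvn hU h1U hgen
  obtain ⟨C, hC, hUC⟩ := good_uniform (sp.good (by rw [hA]; simpa using hnd) haper) U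
  obtain ⟨A₀, hA0, hdiag⟩ := sp.diag hC h1U hUC hdoub
  obtain ⟨K, hK⟩ := sp.tail_bound hAU hU h1U hgen hdoub (ε / 2) (by positivity)
  obtain ⟨D, hD⟩ := hdoub (K * 2)
  set δ : ℝ := ε / (2 * (D * A₀ + 1)) with hδ
  have hDA : 0 < D * A₀ + 1 := by positivity
  have hδ0 : 0 < δ := by positivity
  have hev : ∀ᶠ n : ℕ in atTop, r n / Real.sqrt n < δ * ε / (2 * C + 1) :=
    hr.eventually_lt_const (by positivity)
  obtain ⟨N, hN⟩ := eventually_atTop.1 hev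
  refine ⟨N + 1, fun n hn => ?_⟩
  have hn1 : 1 ≤ n := by omega
  have hrn := hN n (by omega)
  have hn0 : (0 : ℝ) < n := by exact_mod_cast hn1
  set j := n / 4 with hj
  set u := ‖sp.vec j‖ ^ 2 with hu
  have hu0 : 0 ≤ u := by positivity
  set B := U ^ (K * (Nat.sqrt n + 1)) with hB
  have hBu : u * B.card ≤ D * A₀ := by
    have hs : Nat.sqrt n + 1 ≤ 2 * (Nat.sqrt j + 1) := by
      have a1 := Nat.lt_succ_sqrt j
      have a2 := Nat.sqrt_le n
      simp only [Nat.succ_eq_add_one] at a1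
      have a3 : n < 4 * ((Nat.sqrt j + 1) * (Nat.sqrt j + 1)) := by omega
      by_contra hcon
      push Not at hcon
      have : 2 * (Nat.sqrt j + 1) ≤ Nat.sqrt n := by omega
      nlinarith
    have : B.card ≤ D * (U ^ Nat.sqrt j).card := by
      refine (Finset.card_le_card (Finset.pow_subset_pow_right h1U ?_)).trans (hD (Nat.sqrt j))
      rw [mul_assoc]; exact Nat.mul_le_mul_left _ hs
    have h2 : (B.card : ℝ) ≤ D * (U ^ Nat.sqrt j).card := by exact_mod_cast this
    calc u * B.card ≤ u * (D * (U ^ Nat.sqrt j).card) := by gcongr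
      _ = D * (u * (U ^ Nat.sqrt j).card) := by ring
      _ ≤ _ := by gcongr; exact hdiag j
  refine ⟨{h | h ∈ B ∧ δ * u ≤ convPow μ n h}, ?_, ?_⟩
  · set V : Set G := {h | h ∈ B ∧ δ * u ≤ convPow μ n h}
    have e1 : measOf (convPow μ n) V = ∑' x, convPow μ n x * (if x ∈ V then 1 else 0) := by
      rw [measOf, tsum_subtype V (convPow μ n)]
      refine tsum_congr fun x => ?_
      by_cases hx : x ∈ V <;> simp [hx]
    have sB : Summable fun x : G => if x ∈ B then δ * u else 0 :=
      summable_of_ne_finset_zero (s := B) fun x hx => by simp [hx]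
    have e2 : ∑' x : G, (if x ∈ B then δ * u else 0) = B.card * (δ * u) := by
      rw [tsum_eq_sum (s := B) fun x hx => by simp [hx]]
      rw [Finset.sum_congr rfl fun x hx => if_pos hx]; simp
    have e3 : 1 ≤ measOf (convPow μ n) V + tail μ U n (K * (Nat.sqrt n + 1)) + B.card * (δ * u) := by
      conv_lhs => rw [← sp.mass n]
      rw [e1, ← e2, tail, ← (sp.summable n _).tsum_add (sp.summable n _),
        ← ((sp.summable n _).add (sp.summable n _)).tsum_add sB]
      refine Summable.tsum_le_tsum (fun x => ?_) (sp.psummable n)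
        (((sp.summable n _).add (sp.summable n _)).add sB)
      have p0 := sp.pnn n x
      have p1 : 0 ≤ δ * u := by positivity
      by_cases hxB : x ∈ B
      · by_cases hxV : δ * u ≤ convPow μ n x
        · have : x ∈ V := ⟨hxB, hxV⟩
          rw [if_pos this, if_pos hxB, if_pos hxB]; linarith
        · have : x ∉ V := fun hh => hxV hh.2
          rw [if_neg this, if_pos hxB, if_pos hxB]; linarith
      · have : x ∉ V := fun hh => hxB hh.1
        rw [if_neg this, if_neg hxB, if_neg hxB]; linarith
    have e4 := hK n hn1
    have e5 : B.card * (δ * u) ≤ ε / 2 := by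
      calc B.card * (δ * u) = δ * (u * B.card) := by ring
        _ ≤ δ * (D * A₀ + 1) := by gcongr; linarith
        _ = ε / 2 := by rw [hδ]; field_simp
    linarith
  · rintro h ⟨hB, hh⟩ g hg
    have hgm := wl_mem hSgen hSU hU g
    have gr := sp.grad hC hUC (j := j) (m := n - 2 * j) (by omega) hgm h
    rw [show n - 2 * j + 2 * j = n by omega, ← hu] at gr
    set q := Real.sqrt ((j : ℝ) + 1)
    have hq : 0 < q := Real.sqrt_pos.2 (by positivity)
    have hsn : 0 < Real.sqrt n := Real.sqrt_pos.2 hn0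
    have hqn : Real.sqrt n ≤ 2 * q := by
      refine Real.sqrt_le_iff.2 ⟨by positivity, ?_⟩
      rw [mul_pow, Real.sq_sqrt (by positivity)]
      have : n ≤ 4 * (j + 1) := by omega
      have : (n : ℝ) ≤ 4 * (j + 1) := by exact_mod_cast this
      linarith
    have h1 : (wordLength (S : Set G) g : ℝ) / q * C ≤ δ * ε := by
      rw [div_lt_div_iff₀ hsn (by positivity)] at hrn
      rw [div_mul_eq_mul_div, div_le_iff₀ hq]
      have w0 : (0 : ℝ) ≤ wordLength (S : Set G) g := by positivity
      have : δ * ε * Real.sqrt n ≤ δ * ε * (2 * q) := by gcongr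
      have : (wordLength (S : Set G) g : ℝ) * C ≤ r n * C := by gcongr
      nlinarith
    have h2 : |convPow μ n (h * g) - convPow μ n h| ≤ ε * convPow μ n h := by
      refine gr.trans ?_
      calc _ = (wordLength (S : Set G) g : ℝ) / q * C * u := by ring
        _ ≤ δ * ε * u := by gcongr
        _ = ε * (δ * u) := by ring
        _ ≤ _ := by gcongr
    rw [abs_le] at h2
    constructor <;> linarith
end final
end part9

/-- Simple random walks on virtually nilpotent groups are almost invariant
on any scale `r(n)` with `r(n)/√n → 0`. -/
theorem stmt10 {G : Type*} [Group G] [Countable G]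
    (hvn : ∃ H : Subgroup G, H.FiniteIndex ∧ Group.IsNilpotent H)
    (S : Finset G) (hSgen : Subgroup.closure (S : Set G) = ⊤)
    (μ : G → ℝ) (hμ0 : ∀ g, 0 ≤ μ g) (hμ1 : HasSum μ 1)
    (hfin : (Function.support μ).Finite)
    (hsym : ∀ g : G, μ g = μ g⁻¹)
    (hnd : Subsemigroup.closure (Function.support μ) = ⊤)
    (haper : ∀ d : ℕ, (∀ n : ℕ, 1 ≤ n → 0 < convPow μ n 1 → d ∣ n) → d = 1)
    (r : ℕ → ℝ) (hr0 : ∀ n, 0 ≤ r n)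
    (hr : Tendsto (fun n => r n / Real.sqrt n) atTop (nhds 0)) :
    ∀ ε > (0 : ℝ), ∃ N : ℕ, ∀ n ≥ N, ∃ V : Set G,
      1 - ε ≤ measOf (convPow μ n) V ∧
      ∀ h ∈ V, ∀ g : G, (wordLength (S : Set G) g : ℝ) ≤ r n →
        (1 - ε) * convPow μ n h ≤ convPow μ n (h * g) ∧
          convPow μ n (h * g) ≤ (1 + ε) * convPow μ n h := by
  intro ε hε
  exact core hvn S hSgen μ hμ0 hμ1 hfin hsym hnd haper r hr ε hε
end
end
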